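/- Let $(R,\mathfrak{m},k)$ be a Cohen--Macaulay commutative noetherian local ring of dimension $d>0$ admitting a canonical module. If $R$ satisfies the depth formula property (dep), then for all finitely generated $R$-modules $M,N$ with $\operatorname{Ext}_R^i(M,N)=0$ for all $i \gg 0$, one has $\operatorname{Ext}_R^i(M,N)=0$ for all $i > d$. -/

import Mathlib

open CategoryTheory IsLocalRing

noncomputable section

/-- The `i`-th Ext group of `R`-modules `M`, `N`, as a `ModuleCat R`. -/
def ExtGroup (R : Type) [CommRing R] (i : ℕ) (M N : ModuleCat.{0} R) : ModuleCat R :=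
  ((Ext R (ModuleCat.{0} R) i).obj (Opposite.op M)).obj N

/-- The `i`-th Tor group. -/
def TorGroup (R : Type) [CommRing R] (i : ℕ) (M N : ModuleCat.{0} R) : ModuleCat R :=
  ((Tor (ModuleCat.{0} R) i).obj M).obj N

/-- `Ext_R^i(M, N) = 0` for all `i ≫ 0`. -/
def ExtEventuallyZero (R : Type) [CommRing R] (M N : ModuleCat.{0} R) : Prop :=
  ∃ t : ℕ, ∀ i > t, Subsingleton (ExtGroup R i M N)

/-- Property (ee). -/
def PropEE (R : Type) [CommRing R] : Prop :=
  ∀ M N : ModuleCat.{0} R, Module.Finite R M → Module.Finite R N →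
    ExtEventuallyZero R M N → ExtEventuallyZero R N M

/-- Gorenstein: `Ext^i(k, R) = 0` for `i ≫ 0`. -/
def IsGorensteinLocalRing (R : Type) [CommRing R] [IsLocalRing R] : Prop :=
  ∃ t : ℕ, ∀ i > t, Subsingleton
    (ExtGroup R i (ModuleCat.of R (ResidueField R)) (ModuleCat.of R R))

open Classical in
/-- depth of a module over a local ring, with depth of zero module = ⊤. -/
def rdepth (R : Type) [CommRing R] [IsLocalRing R]
    (M : Type) [AddCommGroup M] [Module R M] : ℕ∞ :=
  if Subsingleton M then ⊤ else
    sSup {n : ℕ∞ | ∃ rs : List R, (rs.length : ℕ∞) = n ∧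
      (∀ r ∈ rs, r ∈ maximalIdeal R) ∧ RingTheory.Sequence.IsRegular M rs}

/-- Totally reflexive module. -/
def IsTotallyReflexive (R : Type) [CommRing R]
    (M : Type) [AddCommGroup M] [Module R M] : Prop :=
  Module.Finite R M ∧ Function.Bijective (Module.Dual.eval R M) ∧
  (∀ i > 0, Subsingleton (ExtGroup R i (ModuleCat.of R M) (ModuleCat.of R R))) ∧
  (∀ i > 0, Subsingleton
    (ExtGroup R i (ModuleCat.of R (Module.Dual R M)) (ModuleCat.of R R)))

/-- Property (tr). -/
def PropTR (R : Type) [CommRing R] : Prop :=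
  ∀ (M : Type) [AddCommGroup M] [Module R M], Module.Finite R M →
    (∀ i > 0, Subsingleton (ExtGroup R i (ModuleCat.of R M) (ModuleCat.of R R))) →
    IsTotallyReflexive R M

/-- Property (dep): the depth formula (written additively to avoid truncated subtraction). -/
def PropDep (R : Type) [CommRing R] [IsLocalRing R] : Prop :=
  ∀ (M N : Type) [AddCommGroup M] [Module R M] [AddCommGroup N] [Module R N],
    Module.Finite R M → Module.Finite R N → Nontrivial M → Nontrivial N →
    (∀ i > 0, Subsingleton (TorGroup R i (ModuleCat.of R M) (ModuleCat.of R N))) →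
    rdepth R (TensorProduct R M N) + rdepth R R = rdepth R M + rdepth R N

/-- AB ring. -/
def IsABRing (R : Type) [CommRing R] [IsLocalRing R] : Prop :=
  IsGorensteinLocalRing R ∧ ∃ n : ℕ, ∀ M N : ModuleCat.{0} R,
    Module.Finite R M → Module.Finite R N → ExtEventuallyZero R M N →
    ∀ i > n, Subsingleton (ExtGroup R i M N)

/-- A complex of finitely generated projective modules, indexed by `ℤ`. -/
structure FGProjComplex (R : Type) [CommRing R] where
  X : ℤ → Type
  [acg : ∀ n, AddCommGroup (X n)]
  [mod : ∀ n, Module R (X n)]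
  [fin : ∀ n, Module.Finite R (X n)]
  [proj : ∀ n, Module.Projective R (X n)]
  d : ∀ n : ℤ, X n →ₗ[R] X (n + 1)
  dd : ∀ n : ℤ, (d (n + 1)).comp (d n) = 0

attribute [instance] FGProjComplex.acg FGProjComplex.mod FGProjComplex.fin FGProjComplex.proj

/-- Acyclicity of such a complex. -/
def FGProjComplex.Acyclic {R : Type} [CommRing R] (C : FGProjComplex R) : Prop :=
  ∀ n : ℤ, LinearMap.ker (C.d (n + 1)) = LinearMap.range (C.d n)

/-- The dual complex is acyclic. -/
def FGProjComplex.DualAcyclic {R : Type} [CommRing R] (C : FGProjComplex R) : Prop :=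
  ∀ n : ℤ, LinearMap.ker ((C.d n).dualMap) = LinearMap.range ((C.d (n + 1)).dualMap)

/-- Property (tac): every acyclic complex of f.g. projective modules is totally acyclic. -/
def PropTAC (R : Type) [CommRing R] : Prop :=
  ∀ C : FGProjComplex R, C.Acyclic → C.DualAcyclic

/-- `M` is an ∞-syzygy. -/
def IsInfiniteSyzygy (R : Type) [CommRing R]
    (M : Type) [AddCommGroup M] [Module R M] : Prop :=
  Module.Finite R M ∧
  ∃ (k : ℕ → ℕ) (f : M →ₗ[R] (Fin (k 0) → R))
    (d : ∀ n : ℕ, (Fin (k n) → R) →ₗ[R] (Fin (k (n + 1)) → R)),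
    Function.Injective f ∧ LinearMap.ker (d 0) = LinearMap.range f ∧
    ∀ n : ℕ, LinearMap.ker (d (n + 1)) = LinearMap.range (d n)

end

noncomputable section

/-- Minimal `n`-th syzygy: `IsMinimalSyzygy R n M K` says `K` is the `n`-th syzygy of `M`
computed from a minimal free resolution. -/
def IsMinimalSyzygy (R : Type) [CommRing R] [IsLocalRing R] :
    ℕ → ModuleCat.{0} R → ModuleCat.{0} R → Prop
  | 0, M, K => Nonempty (K ≃ₗ[R] M)
  | n + 1, M, K => ∃ (m : ℕ) (f : (Fin m → R) →ₗ[R] M),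
      Function.Surjective f ∧
      (LinearMap.ker f ≤ (maximalIdeal R) • (⊤ : Submodule R (Fin m → R))) ∧
      IsMinimalSyzygy R n (ModuleCat.of R (LinearMap.ker f)) K

/-- A resolving class of modules: contains `R`, closed under isomorphisms, direct summands,
extensions and syzygies. -/
def IsResolvingClass (R : Type) [CommRing R] (P : ModuleCat.{0} R → Prop) : Prop :=
  (P (ModuleCat.of R R)) ∧
  (∀ X Y : ModuleCat.{0} R, Nonempty (X ≃ₗ[R] Y) → P X → P Y) ∧
  (∀ (X Y : ModuleCat.{0} R) (i : X →ₗ[R] Y) (r : Y →ₗ[R] X),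
      r.comp i = LinearMap.id → P Y → P X) ∧
  (∀ (X Y Z : ModuleCat.{0} R) (f : X →ₗ[R] Y) (g : Y →ₗ[R] Z),
      Function.Injective f → Function.Surjective g → LinearMap.ker g = LinearMap.range f →
      P X → P Z → P Y) ∧
  (∀ (X Y : ModuleCat.{0} R) (m : ℕ) (f : (Fin m → R) →ₗ[R] X), Function.Surjective f →
      Nonempty (Y ≃ₗ[R] LinearMap.ker f) → P X → P Y)

/-- `N` belongs to the resolving closure `res M`. -/
def InResolvingClosure (R : Type) [CommRing R] (M N : ModuleCat.{0} R) : Prop :=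
  ∀ P : ModuleCat.{0} R → Prop, IsResolvingClass R P → P M → P N

/-- `M` has finite G-dimension: it admits a finite resolution by totally reflexive modules. -/
def HasFiniteGDim (R : Type) [CommRing R] (M : Type) [AddCommGroup M] [Module R M] : Prop :=
  ∃ (n : ℕ) (T : ℕ → ModuleCat.{0} R) (d : ∀ i : ℕ, T (i + 1) →ₗ[R] T i) (ε : T 0 →ₗ[R] M),
    (∀ i, IsTotallyReflexive R (T i)) ∧ Function.Surjective ε ∧
    LinearMap.ker ε = LinearMap.range (d 0) ∧
    (∀ i, LinearMap.ker (d i) = LinearMap.range (d (i + 1))) ∧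
    (∀ i > n, Subsingleton (T i))

/-- `ω` is a canonical module of the `d`-dimensional Cohen–Macaulay local ring `R`:
`Ext^i(k, ω)` vanishes for `i ≠ d` and is isomorphic to `k` for `i = d`. -/
def IsCanonicalModule (R : Type) [CommRing R] [IsLocalRing R] (d : ℕ)
    (ω : ModuleCat.{0} R) : Prop :=
  Module.Finite R ω ∧
  (∀ i : ℕ, i ≠ d → Subsingleton (ExtGroup R i (ModuleCat.of R (ResidueField R)) ω)) ∧
  Nonempty ((ExtGroup R d (ModuleCat.of R (ResidueField R)) ω) ≃ₗ[R] (ResidueField R))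

/-- Cohen–Macaulay local ring: depth equals Krull dimension. -/
def IsCohenMacaulayLocalRing (R : Type) [CommRing R] [IsLocalRing R] : Prop :=
  (rdepth R R : WithBot ℕ∞) = ringKrullDim R

end

section ExtVanishing

variable {R : Type} [CommRing R]

/-- Vanishing of the `i`-th Ext group, for unbundled modules. -/
def ExtVanishes (R : Type) [CommRing R] (A B : Type) [AddCommGroup A] [Module R A]
    [AddCommGroup B] [Module R B] (i : ℕ) : Prop :=
  Subsingleton (Abelian.Ext (ModuleCat.of R A) (ModuleCat.of R B) i)

variable {A B C M : Type} [AddCommGroup A] [Module R A] [AddCommGroup B] [Module R B]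
  [AddCommGroup C] [Module R C] [AddCommGroup M] [Module R M]

/-- The short complex of a pair of composable linear maps forming an exact sequence. -/
abbrev exactShortComplex {f : A →ₗ[R] B} {g : B →ₗ[R] C} (hfg : Function.Exact f g) :
    ShortComplex (ModuleCat.{0} R) :=
  ShortComplex.mk (ModuleCat.ofHom f) (ModuleCat.ofHom g)
    (ModuleCat.hom_ext hfg.linearMap_comp_eq_zero)

lemma exactShortComplex_shortExact {f : A →ₗ[R] B} {g : B →ₗ[R] C} (hf : Function.Injective f)
    (hfg : Function.Exact f g) (hg : Function.Surjective g) :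
    (exactShortComplex hfg).ShortExact where
  exact := (ShortComplex.ShortExact.moduleCat_exact_iff_function_exact _).mpr hfg
  mono_f := (ModuleCat.mono_iff_injective _).mpr hf
  epi_g := (ModuleCat.epi_iff_surjective _).mpr hg

namespace ExtVanishes

section

variable {f : A →ₗ[R] B} {g : B →ₗ[R] C} (hf : Function.Injective f)
    (hfg : Function.Exact f g) (hg : Function.Surjective g)

include hf hfg hg

lemma covariant₁ {i j : ℕ} (hij : i + 1 = j) (h₃ : ExtVanishes R M C i)
    (h₂ : ExtVanishes R M B j) : ExtVanishes R M A j := by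
  have hS := exactShortComplex_shortExact hf hfg hg
  refine subsingleton_of_forall_eq 0 fun x ↦ ?_
  obtain ⟨y, rfl⟩ := Abelian.Ext.covariant_sequence_exact₁ _ hS x (h₂.elim _ _) hij
  rw [h₃.elim y 0, Abelian.Ext.zero_comp]

lemma covariant₂ {i : ℕ} (h₁ : ExtVanishes R M A i)
    (h₃ : ExtVanishes R M C i) : ExtVanishes R M B i := by
  have hS := exactShortComplex_shortExact hf hfg hg
  refine subsingleton_of_forall_eq 0 fun x ↦ ?_
  obtain ⟨y, rfl⟩ := Abelian.Ext.covariant_sequence_exact₂ _ hS x (h₃.elim _ _)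
  rw [h₁.elim y 0, Abelian.Ext.zero_comp]

lemma covariant₃ {i j : ℕ} (hij : i + 1 = j) (h₂ : ExtVanishes R M B i)
    (h₁ : ExtVanishes R M A j) : ExtVanishes R M C i := by
  have hS := exactShortComplex_shortExact hf hfg hg
  refine subsingleton_of_forall_eq 0 fun x ↦ ?_
  obtain ⟨y, rfl⟩ := Abelian.Ext.covariant_sequence_exact₃ _ hS x hij (h₁.elim _ _)
  rw [h₂.elim y 0, Abelian.Ext.zero_comp]

lemma contravariant₁ {i j : ℕ} (hij : i + 1 = j) (h₂ : ExtVanishes R B M i)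
    (h₃ : ExtVanishes R C M j) : ExtVanishes R A M i := by
  have hS := exactShortComplex_shortExact hf hfg hg
  refine subsingleton_of_forall_eq 0 fun x ↦ ?_
  obtain ⟨y, rfl⟩ := Abelian.Ext.contravariant_sequence_exact₁ hS _ x
    ((add_comm 1 i).trans hij) (h₃.elim _ _)
  rw [h₂.elim y 0, Abelian.Ext.comp_zero]

lemma contravariant₂ {i : ℕ} (h₁ : ExtVanishes R A M i)
    (h₃ : ExtVanishes R C M i) : ExtVanishes R B M i := by
  have hS := exactShortComplex_shortExact hf hfg hg
  refine subsingleton_of_forall_eq 0 fun x ↦ ?_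
  obtain ⟨y, rfl⟩ := Abelian.Ext.contravariant_sequence_exact₂ hS _ x (h₁.elim _ _)
  rw [h₃.elim y 0, Abelian.Ext.comp_zero]

lemma contravariant₃ {i j : ℕ} (hij : i + 1 = j) (h₁ : ExtVanishes R A M i)
    (h₂ : ExtVanishes R B M j) : ExtVanishes R C M j := by
  have hS := exactShortComplex_shortExact hf hfg hg
  refine subsingleton_of_forall_eq 0 fun x ↦ ?_
  obtain ⟨y, rfl⟩ := Abelian.Ext.contravariant_sequence_exact₃ hS _ x (h₂.elim _ _)
    ((add_comm 1 i).trans hij)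
  rw [h₁.elim y 0, Abelian.Ext.comp_zero]

/-- If the first Ext group of the cokernel vanishes, maps extend along an injection. -/
lemma surjective_lcomp (h : ExtVanishes R C M 1) :
    Function.Surjective (LinearMap.lcomp R M f) := by
  have hS := exactShortComplex_shortExact hf hfg hg
  intro φ
  obtain ⟨y, hy⟩ := Abelian.Ext.contravariant_sequence_exact₁ hS _
    (Abelian.Ext.mk₀ (ModuleCat.ofHom φ)) (add_zero 1) (h.elim _ _)
  obtain ⟨y, rfl⟩ := Abelian.Ext.mk₀_bijective _ _ |>.2 y
  rw [Abelian.Ext.mk₀_comp_mk₀] at hy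
  have := (Abelian.Ext.mk₀_bijective _ _).1 hy
  exact ⟨y.hom, congrArg ModuleCat.Hom.hom this⟩

/-- If the first Ext group into the kernel vanishes, maps lift along a surjection. -/
lemma exists_comp_eq (h : ExtVanishes R M A 1) (φ : M →ₗ[R] C) :
    ∃ ψ : M →ₗ[R] B, g ∘ₗ ψ = φ := by
  have hS := exactShortComplex_shortExact hf hfg hg
  obtain ⟨y, hy⟩ := Abelian.Ext.covariant_sequence_exact₃ _ hS
    (Abelian.Ext.mk₀ (ModuleCat.ofHom φ)) (zero_add 1) (h.elim _ _)
  obtain ⟨y, rfl⟩ := Abelian.Ext.mk₀_bijective _ _ |>.2 y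
  rw [Abelian.Ext.mk₀_comp_mk₀] at hy
  have := (Abelian.Ext.mk₀_bijective _ _).1 hy
  exact ⟨y.hom, congrArg ModuleCat.Hom.hom this⟩

end

lemma of_equiv {A' B' : Type} [AddCommGroup A'] [Module R A'] [AddCommGroup B'] [Module R B']
    (e : A ≃ₗ[R] A') (e' : B ≃ₗ[R] B') {i : ℕ} (h : ExtVanishes R A B i) :
    ExtVanishes R A' B' i := by
  refine subsingleton_of_forall_eq 0 fun x ↦ ?_
  obtain ⟨a⟩ : Nonempty (ModuleCat.of R A' ≅ ModuleCat.of R A) := ⟨e.symm.toModuleIso⟩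
  obtain ⟨b⟩ : Nonempty (ModuleCat.of R B' ≅ ModuleCat.of R B) := ⟨e'.symm.toModuleIso⟩
  have h₁ : x = (Abelian.Ext.mk₀ a.hom).comp
      ((((Abelian.Ext.mk₀ a.inv).comp x (zero_add i)).comp
        (Abelian.Ext.mk₀ b.hom) (add_zero i)).comp
        (Abelian.Ext.mk₀ b.inv) (add_zero i)) (zero_add i) := by
    simp
  rw [h₁, h.elim (((Abelian.Ext.mk₀ a.inv).comp x (zero_add i)).comp
        (Abelian.Ext.mk₀ b.hom) (add_zero i)) 0]
  simp

lemma zero_iff : ExtVanishes R A B 0 ↔ Subsingleton (A →ₗ[R] B) :=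
  ((Abelian.Ext.addEquiv₀ (X := ModuleCat.of R A) (Y := ModuleCat.of R B)).toEquiv.trans
    ModuleCat.homEquiv).subsingleton_congr

lemma of_projective [Module.Projective R A] {i : ℕ} (hi : 0 < i) : ExtVanishes R A B i := by
  obtain ⟨j, rfl⟩ := Nat.exists_eq_succ_of_ne_zero hi.ne'
  have : Projective (ModuleCat.of R A) := inferInstance
  exact subsingleton_of_forall_eq 0 fun x ↦ Abelian.Ext.eq_zero_of_projective x

lemma of_subsingleton_left [Subsingleton A] (i : ℕ) : ExtVanishes R A B i := by
  refine subsingleton_of_forall_eq 0 fun x ↦ ?_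
  rw [← Abelian.Ext.mk₀_id_comp x, show 𝟙 (ModuleCat.of R A) = 0 from
    ModuleCat.hom_ext (LinearMap.ext fun a ↦ Subsingleton.elim (α := A) _ _)]
  simp

lemma of_subsingleton_right [Subsingleton B] (i : ℕ) : ExtVanishes R A B i := by
  refine subsingleton_of_forall_eq 0 fun x ↦ ?_
  rw [← Abelian.Ext.comp_mk₀_id x, show 𝟙 (ModuleCat.of R B) = 0 from
    ModuleCat.hom_ext (LinearMap.ext fun a ↦ Subsingleton.elim (α := B) _ _)]
  simp

lemma prod_right {i : ℕ} (h₁ : ExtVanishes R M A i) (h₂ : ExtVanishes R M B i) :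
    ExtVanishes R M (A × B) i :=
  covariant₂ (f := LinearMap.inl R A B) (g := LinearMap.snd R A B)
    LinearMap.inl_injective Function.Exact.inl_snd LinearMap.snd_surjective h₁ h₂

lemma pi_right {i : ℕ} (h : ExtVanishes R M A i) (n : ℕ) : ExtVanishes R M (Fin n → A) i := by
  induction n with
  | zero => exact of_subsingleton_right i
  | succ n ih =>
    exact (prod_right h ih).of_equiv (.refl R M) (Fin.consLinearEquiv R fun _ ↦ A)

/-- Nakayama's lemma for Ext modules. -/
lemma of_forall_eq_smul [IsNoetherianRing R] [IsLocalRing R] [Module.Finite R A]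
    [Module.Finite R B] {i : ℕ} {x : R} (hx : x ∈ maximalIdeal R)
    (h : ∀ e : Abelian.Ext (ModuleCat.of R A) (ModuleCat.of R B) i, ∃ e', e = x • e') :
    ExtVanishes R A B i := by
  have : Module.Finite R (Abelian.Ext (ModuleCat.of R A) (ModuleCat.of R B) i) := by
    infer_instance
  have htop : (⊤ : Submodule R (Abelian.Ext (ModuleCat.of R A) (ModuleCat.of R B) i)) = ⊥ := by
    refine Submodule.eq_bot_of_le_smul_of_le_jacobson_bot (maximalIdeal R) _ Module.Finite.fg_top
      (fun e _ ↦ ?_) (IsLocalRing.jacobson_eq_maximalIdeal ⊥ bot_ne_top).ge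
    obtain ⟨e', rfl⟩ := h e
    exact Submodule.smul_mem_smul hx trivial
  exact (Submodule.subsingleton_iff R).mp (subsingleton_of_bot_eq_top htop.symm)

end ExtVanishes

end ExtVanishing

section Comparison

variable {R : Type} [CommRing R]

lemma extMk_smul {X Y : ModuleCat.{0} R} (P : ProjectiveResolution X) {n m : ℕ} (hm : n + 1 = m)
    (f : P.complex.X n ⟶ Y) (hf : P.complex.d m n ≫ f = 0) (r : R) :
    P.extMk (r • f) m hm (by simp [hf]) = r • P.extMk f m hm hf := by
  have h := P.extMk_comp_mk₀ f m hm hf (r • 𝟙 Y)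
  simp only [Linear.comp_smul, Category.comp_id, Abelian.Ext.mk₀_smul, Abelian.Ext.comp_smul,
    Abelian.Ext.comp_mk₀_id] at h
  exact h.symm

/-- The linear map from cocycles of the Hom complex to Ext. -/
noncomputable def cocyclesToExt {X : ModuleCat.{0} R} (P : ProjectiveResolution X)
    (Y : ModuleCat.{0} R) (p n m : ℕ) (hm : n + 1 = m) :
    LinearMap.ker ((P.complex.linearYonedaObj R Y).sc' p n m).g.hom →ₗ[R] Abelian.Ext X Y n where
  toFun f := P.extMk (f.1 : P.complex.X n ⟶ Y) m hm f.2
  map_add' f g := (P.add_extMk _ _ m hm f.2 g.2).symm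
  map_smul' r f := extMk_smul P hm _ f.2 r

lemma cocyclesToExt_surjective {X : ModuleCat.{0} R} (P : ProjectiveResolution X)
    (Y : ModuleCat.{0} R) (p n m : ℕ) (hm : n + 1 = m) :
    Function.Surjective (cocyclesToExt P Y p n m hm) := fun e ↦ by
  obtain ⟨f, hf, rfl⟩ := P.extMk_surjective e m hm
  exact ⟨⟨f, hf⟩, rfl⟩

lemma ker_cocyclesToExt {X : ModuleCat.{0} R} (P : ProjectiveResolution X)
    (Y : ModuleCat.{0} R) (p n m : ℕ) (hm : n + 1 = m) (hp : p + 1 = n) :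
    LinearMap.ker (cocyclesToExt P Y p n m hm) =
      LinearMap.range ((P.complex.linearYonedaObj R Y).sc' p n m).moduleCatToCycles := by
  ext ⟨f, hf⟩
  rw [LinearMap.mem_ker]
  refine (P.extMk_eq_zero_iff f m hm hf p hp).trans ?_
  constructor
  · rintro ⟨g, hg⟩
    exact ⟨g, Subtype.ext hg⟩
  · rintro ⟨g, hg⟩
    exact ⟨g, congrArg Subtype.val hg⟩

/-- The two models of Ext agree in positive degrees. -/
lemma nonempty_extGroup_linearEquiv (X Y : ModuleCat.{0} R) (p : ℕ) :
    Nonempty (ExtGroup R (p + 1) X Y ≃ₗ[R] Abelian.Ext X Y (p + 1)) := by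
  let P := projectiveResolution X
  let K := P.complex.linearYonedaObj R Y
  let e := ((P.isoExt (R := R) (p + 1) Y).trans
    (K.homologyIsoSc' p (p + 1) (p + 2) (by simp) (by simp))).trans
    (K.sc' p (p + 1) (p + 2)).moduleCatHomologyIso
  exact ⟨e.toLinearEquiv.trans ((Submodule.quotEquivOfEq _ _
    (ker_cocyclesToExt P Y p (p + 1) (p + 2) rfl rfl).symm).trans
    ((cocyclesToExt P Y p (p + 1) (p + 2) rfl).quotKerEquivOfSurjective
      (cocyclesToExt_surjective P Y p (p + 1) (p + 2) rfl)))⟩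

lemma extVanishes_iff_extGroup_succ (X Y : ModuleCat.{0} R) (p : ℕ) :
    Subsingleton (ExtGroup R (p + 1) X Y) ↔ ExtVanishes R X Y (p + 1) := by
  obtain ⟨e⟩ := nonempty_extGroup_linearEquiv X Y p
  exact e.toEquiv.subsingleton_congr

lemma ExtVanishes.of_extGroup_zero {X Y : ModuleCat.{0} R}
    (h : Subsingleton (ExtGroup R 0 X Y)) : ExtVanishes R X Y 0 := by
  let P := projectiveResolution X
  let K := P.complex.linearYonedaObj R Y
  have hK : K.ExactAt 0 := by
    rw [HomologicalComplex.exactAt_iff_isZero_homology]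
    exact (ModuleCat.isZero_of_subsingleton (ExtGroup R 0 X Y)).of_iso (P.isoExt 0 Y).symm
  rw [K.exactAt_iff' 0 0 1 (by simp) (by simp), ShortComplex.moduleCat_exact_iff] at hK
  refine subsingleton_of_forall_eq 0 fun e ↦ ?_
  obtain ⟨f, hf, rfl⟩ := P.extMk_surjective e 1 rfl
  obtain ⟨g, hg⟩ := hK f hf
  have : f = 0 := by
    rw [← show K.d 0 0 g = f from hg, K.shape 0 0 (by simp)]
    rfl
  subst this
  exact P.extMk_zero 1 rfl

end Comparison

section Towers

variable {R : Type} [CommRing R]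

/-- A free resolution by finite free modules, cut into short exact sequences
`0 → Z (n + 1) → R ^ rank n → Z n → 0`. -/
structure SyzygyTower (R : Type) [CommRing R] (Z : ℕ → Type) [∀ n, AddCommGroup (Z n)]
    [∀ n, Module R (Z n)] where
  rank : ℕ → ℕ
  ι : ∀ n, Z (n + 1) →ₗ[R] (Fin (rank n) → R)
  π : ∀ n, (Fin (rank n) → R) →ₗ[R] Z n
  injective : ∀ n, Function.Injective (ι n)
  exact : ∀ n, Function.Exact (ι n) (π n)
  surjective : ∀ n, Function.Surjective (π n)

namespace SyzygyTower

variable {Z : ℕ → Type} [∀ n, AddCommGroup (Z n)] [∀ n, Module R (Z n)] (T : SyzygyTower R Z)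

/-- The differential of the spliced free resolution. -/
def d (n : ℕ) : (Fin (T.rank (n + 1)) → R) →ₗ[R] (Fin (T.rank n) → R) :=
  T.ι n ∘ₗ T.π (n + 1)

lemma π_comp_d (n : ℕ) : T.π n ∘ₗ T.d n = 0 := by
  rw [d, ← LinearMap.comp_assoc, (T.exact n).linearMap_comp_eq_zero, LinearMap.zero_comp]

lemma d_comp_d (n : ℕ) : T.d n ∘ₗ T.d (n + 1) = 0 := by
  rw [d, LinearMap.comp_assoc, π_comp_d, LinearMap.comp_zero]

lemma exact_d_d (n : ℕ) : Function.Exact (T.d (n + 1)) (T.d n) := by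
  intro x
  rw [d, d, LinearMap.comp_apply, map_eq_zero_iff _ (T.injective n), T.exact (n + 1) x]
  constructor
  · rintro ⟨y, rfl⟩
    obtain ⟨z, rfl⟩ := T.surjective (n + 2) y
    exact ⟨z, rfl⟩
  · rintro ⟨y, rfl⟩
    exact ⟨_, rfl⟩

lemma exact_d_π : Function.Exact (T.d 0) (T.π 0) := by
  intro x
  rw [T.exact 0 x, d]
  constructor
  · rintro ⟨y, rfl⟩
    obtain ⟨z, rfl⟩ := T.surjective 1 y
    exact ⟨z, rfl⟩
  · rintro ⟨y, rfl⟩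
    exact ⟨_, rfl⟩

/-- The free resolution as a chain complex. -/
noncomputable def complex : ChainComplex (ModuleCat.{0} R) ℕ :=
  ChainComplex.of (fun n ↦ ModuleCat.of R (Fin (T.rank n) → R)) (fun n ↦ ModuleCat.ofHom (T.d n))
    fun n ↦ by rw [← ModuleCat.ofHom_comp, d_comp_d]; rfl

lemma complex_d (n : ℕ) : T.complex.d (n + 1) n = ModuleCat.ofHom (T.d n) :=
  ChainComplex.of_d (fun n ↦ ModuleCat.of R (Fin (T.rank n) → R))
    (fun n ↦ ModuleCat.ofHom (T.d n)) n

/-- The augmentation. -/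
noncomputable def augmentation :
    T.complex ⟶ (ChainComplex.single₀ (ModuleCat.{0} R)).obj (ModuleCat.of R (Z 0)) :=
  (ChainComplex.toSingle₀Equiv _ _).symm ⟨ModuleCat.ofHom (T.π 0), by
    rw [complex_d]; exact ModuleCat.hom_ext (T.π_comp_d 0)⟩

lemma augmentation_f_zero : T.augmentation.f 0 = ModuleCat.ofHom (T.π 0) :=
  ChainComplex.toSingle₀Equiv_symm_apply_f_zero _ _

lemma complex_exactAt_succ (n : ℕ) : T.complex.ExactAt (n + 1) := by
  rw [HomologicalComplex.exactAt_iff' _ (n + 2) (n + 1) n (by simp) (by simp)]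
  rw [ShortComplex.ShortExact.moduleCat_exact_iff_function_exact]
  have := T.exact_d_d n
  change Function.Exact (T.complex.d (n + 2) (n + 1)) (T.complex.d (n + 1) n)
  rw [complex_d, complex_d]
  exact this

/-- The free resolution as a projective resolution. -/
noncomputable def resolution : ProjectiveResolution (ModuleCat.of R (Z 0)) where
  complex := T.complex
  projective n := inferInstanceAs (Projective (ModuleCat.of R (Fin (T.rank n) → R)))
  π := T.augmentation
  quasiIso := ⟨fun n => by
    cases n
    · rw [ChainComplex.quasiIsoAt₀_iff, ShortComplex.quasiIso_iff_of_zeros']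
      · refine (ShortComplex.exact_and_epi_g_iff_of_iso
          (S₂ := exactShortComplex T.exact_d_π) ?_).2 ⟨?_, ?_⟩
        · exact ShortComplex.isoMk (Iso.refl _) (Iso.refl _) (Iso.refl _)
            ((Category.id_comp _).trans ((T.complex_d 0).symm.trans (Category.comp_id _).symm))
            ((Category.id_comp _).trans
              (T.augmentation_f_zero.symm.trans (Category.comp_id _).symm))
        · exact (ShortComplex.ShortExact.moduleCat_exact_iff_function_exact _).mpr T.exact_d_π
        · exact (ModuleCat.epi_iff_surjective _).mpr (T.surjective 0)
      all_goals rfl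
    · rw [quasiIsoAt_iff_exactAt']
      · apply complex_exactAt_succ
      · apply ChainComplex.exactAt_succ_single_obj⟩

open TensorProduct in
/-- Tor vanishes in positive degrees if tensoring preserves injectivity throughout a tower. -/
lemma subsingleton_torGroup {A : Type} [AddCommGroup A] [Module R A]
    (h : ∀ n, Function.Injective (LinearMap.lTensor A (T.ι n))) {i : ℕ} (hi : 0 < i) :
    Subsingleton (TorGroup R i (ModuleCat.of R A) (ModuleCat.of R (Z 0))) := by
  obtain ⟨n, rfl⟩ := Nat.exists_eq_succ_of_ne_zero hi.ne'
  let F := (MonoidalCategory.tensoringLeft (ModuleCat.{0} R)).obj (ModuleCat.of R A)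
  let K := (F.mapHomologicalComplex _).obj T.complex
  have hK : K.ExactAt (n + 1) := by
    rw [HomologicalComplex.exactAt_iff' _ (n + 2) (n + 1) n (by simp) (by simp)]
    rw [ShortComplex.ShortExact.moduleCat_exact_iff_function_exact]
    have h₁ : K.d (n + 2) (n + 1) = ModuleCat.ofHom (LinearMap.lTensor A (T.d (n + 1))) := by
      simp only [K, Functor.mapHomologicalComplex_obj_d]
      rw [complex_d]
      rfl
    have h₂ : K.d (n + 1) n = ModuleCat.ofHom (LinearMap.lTensor A (T.d n)) := by
      simp only [K, Functor.mapHomologicalComplex_obj_d]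
      rw [complex_d]
      rfl
    change Function.Exact (K.d (n + 2) (n + 1)) (K.d (n + 1) n)
    rw [h₁, h₂]
    intro (x : A ⊗[R] (Fin (T.rank (n + 1)) → R))
    have e : Function.Exact (LinearMap.lTensor A (T.ι (n + 1)))
        (LinearMap.lTensor A (T.π (n + 1))) :=
      lTensor_exact A (T.exact (n + 1)) (T.surjective (n + 1))
    change LinearMap.lTensor A (T.d n) x = 0 ↔ x ∈ Set.range (LinearMap.lTensor A (T.d (n + 1)))
    rw [d, LinearMap.lTensor_comp, LinearMap.comp_apply, map_eq_zero_iff _ (h n), e x, d,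
      LinearMap.lTensor_comp, LinearMap.coe_comp,
      (LinearMap.lTensor_surjective A (T.surjective (n + 2))).range_comp]
  have h0 : Limits.IsZero (K.homology (n + 1)) :=
    (HomologicalComplex.exactAt_iff_isZero_homology ..).mp hK
  exact ModuleCat.subsingleton_of_isZero (h0.of_iso (T.resolution.isoLeftDerivedObj F (n + 1)))

end SyzygyTower

section

variable (R) (M : Type) [AddCommGroup M] [Module R M] [Module.Finite R M]

/-- The rank of a chosen finite free cover. -/
noncomputable def coverRank : ℕ := (Module.Finite.exists_fin' R M).choose

/-- A chosen finite free cover. -/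
noncomputable def cover : (Fin (coverRank R M) → R) →ₗ[R] M :=
  (Module.Finite.exists_fin' R M).choose_spec.choose

lemma cover_surjective : Function.Surjective (cover R M) :=
  (Module.Finite.exists_fin' R M).choose_spec.choose_spec

variable [IsNoetherianRing R]

/-- Iterated syzygies, bundled. -/
noncomputable def syzygyAux : ℕ → {X : ModuleCat.{0} R // Module.Finite R X}
  | 0 => ⟨ModuleCat.of R M, inferInstanceAs (Module.Finite R M)⟩
  | n + 1 =>
    letI := (syzygyAux n).2
    ⟨ModuleCat.of R (LinearMap.ker (cover R (syzygyAux n).1)),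
      inferInstanceAs (Module.Finite R (LinearMap.ker (cover R (syzygyAux n).1)))⟩

/-- The `n`-th syzygy of `M` for the chosen covers. -/
abbrev Syzygy (n : ℕ) : Type := (syzygyAux R M n).1

instance (n : ℕ) : Module.Finite R (Syzygy R M n) := (syzygyAux R M n).2

/-- The tower of chosen syzygies. -/
noncomputable def syzygyTower : SyzygyTower R (Syzygy R M) where
  rank n := coverRank R (Syzygy R M n)
  ι _ := (LinearMap.ker (cover R _)).subtype
  π _ := cover R _
  injective _ := Submodule.subtype_injective _
  exact _ := LinearMap.exact_subtype_ker_map _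
  surjective _ := cover_surjective R _

end

end Towers

section Depth

variable {R : Type} [CommRing R] [IsLocalRing R] [IsNoetherianRing R]
  {M : Type} [AddCommGroup M] [Module R M]

omit [IsNoetherianRing R] in
lemma support_residueField :
    Module.support R (ResidueField R) = PrimeSpectrum.zeroLocus (maximalIdeal R) :=
  (Module.support_eq_zeroLocus (R := R) (M := R ⧸ maximalIdeal R)).trans (by
    rw [Ideal.annihilator_quotient])

omit [IsNoetherianRing R] in
lemma annihilator_residueField :
    Module.annihilator R (ResidueField R) = maximalIdeal R :=
  Ideal.annihilator_quotient (I := maximalIdeal R)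

omit [IsNoetherianRing R] in
lemma maximalIdeal_smul_top_lt [Module.Finite R M] [Nontrivial M] :
    maximalIdeal R • (⊤ : Submodule R M) < ⊤ :=
  lt_top_iff_ne_top.mpr (Submodule.top_ne_ideal_smul_of_le_jacobson_annihilator
    (IsLocalRing.maximalIdeal_le_jacobson _)).symm

lemma ExtVanishes.of_le_rdepth [Module.Finite R M] [Nontrivial M] {n i : ℕ}
    (h : (n : ℕ∞) ≤ rdepth R M) (hi : i < n) : ExtVanishes R (ResidueField R) M i := by
  rw [rdepth, if_neg (not_subsingleton M)] at h
  obtain ⟨s, ⟨rs, rfl, hmem, hreg⟩, hs⟩ := lt_sSup_iff.mp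
    (lt_of_lt_of_le (Nat.cast_lt.mpr hi) h)
  exact ModuleCat.subsingleton_ext_of_exists_isRegular (maximalIdeal R)
    (ModuleCat.of R (ResidueField R)) support_residueField.le (ModuleCat.of R M)
    maximalIdeal_smul_top_lt rs hmem hreg i (Nat.cast_lt.mp hs)

lemma le_rdepth [Module.Finite R M] [Nontrivial M] {n : ℕ}
    (h : ∀ i < n, ExtVanishes R (ResidueField R) M i) : (n : ℕ∞) ≤ rdepth R M := by
  obtain ⟨rs, hlen, hmem, hreg⟩ := ModuleCat.exists_isRegular_of_exists_subsingleton_ext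
    (maximalIdeal R) n (ModuleCat.of R M) maximalIdeal_smul_top_lt
    (ModuleCat.of R (ResidueField R)) support_residueField h
  rw [rdepth, if_neg (not_subsingleton M)]
  exact le_sSup ⟨rs, by rw [hlen], hmem, hreg⟩

lemma exists_isSMulRegular [Module.Finite R M] (h : ExtVanishes R (ResidueField R) M 0) :
    ∃ x ∈ maximalIdeal R, IsSMulRegular M x := by
  rw [ExtVanishes.zero_iff, IsSMulRegular.subsingleton_linearMap_iff] at h
  rwa [annihilator_residueField] at h

omit [IsNoetherianRing R] in
lemma ExtVanishes.of_isFiniteLength {L : Type} [AddCommGroup L] [Module R L]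
    (hL : IsFiniteLength R L) {i : ℕ} (h : ExtVanishes R (ResidueField R) M i) :
    ExtVanishes R L M i := by
  induction hL with
  | of_subsingleton => exact ExtVanishes.of_subsingleton_left i
  | @of_simple_quotient L _ _ N hN _ ih =>
    obtain ⟨I, hI, ⟨e⟩⟩ := isSimpleModule_iff_quot_maximal.mp hN
    obtain rfl := IsLocalRing.eq_maximalIdeal hI
    exact ExtVanishes.contravariant₂ N.subtype_injective (LinearMap.exact_subtype_mkQ N)
      N.mkQ_surjective ih (h.of_equiv e.symm (.refl R M))

section

open Pointwise

omit [IsLocalRing R] [IsNoetherianRing R] in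
lemma exact_lsmul_mkQ (x : R) :
    Function.Exact (LinearMap.lsmul R M x) (x • (⊤ : Submodule R M)).mkQ := by
  intro m
  rw [← LinearMap.mem_ker, Submodule.ker_mkQ, Submodule.mem_smul_pointwise_iff_exists]
  simp

variable {A : Type} [AddCommGroup A] [Module R A] {x : R}

omit [IsLocalRing R] [IsNoetherianRing R] in
lemma ExtVanishes.quotSMulTop_right (hreg : IsSMulRegular M x) {i j : ℕ} (hij : i + 1 = j)
    (h : ExtVanishes R A M i) (h' : ExtVanishes R A M j) :
    ExtVanishes R A (QuotSMulTop x M) i :=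
  covariant₃ (f := LinearMap.lsmul R M x) hreg (exact_lsmul_mkQ x) (Submodule.mkQ_surjective _)
    hij h h'

lemma ExtVanishes.of_quotSMulTop_left [Module.Finite R A] [Module.Finite R M]
    (hx : x ∈ maximalIdeal R) (hreg : IsSMulRegular A x) {i j : ℕ} (hij : i + 1 = j)
    (h : ExtVanishes R (QuotSMulTop x A) M j) : ExtVanishes R A M i := by
  refine of_forall_eq_smul hx fun e ↦ ?_
  obtain ⟨y, hy⟩ := Abelian.Ext.contravariant_sequence_exact₁
    (exactShortComplex_shortExact (f := LinearMap.lsmul R A x) hreg (exact_lsmul_mkQ x)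
    (Submodule.mkQ_surjective _)) _ e ((add_comm 1 i).trans hij) (h.elim _ _)
  refine ⟨y, ?_⟩
  rw [← hy]
  change (Abelian.Ext.mk₀ (x • 𝟙 (ModuleCat.of R A))).comp
    (show Abelian.Ext (ModuleCat.of R A) (ModuleCat.of R M) i from y) (zero_add i) = _
  rw [Abelian.Ext.mk₀_smul, Abelian.Ext.smul_comp]
  exact congrArg (x • ·) (Abelian.Ext.mk₀_id_comp y)

end

/-- Vanishing of Ext from the residue field in all degrees beyond `d` propagates to all
finitely generated modules. -/
lemma ExtVanishes.of_residueField [Module.Finite R M] {d : ℕ}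
    (h : ∀ i > d, ExtVanishes R (ResidueField R) M i) (A : Type) [AddCommGroup A] [Module R A]
    [Module.Finite R A] : ∀ i > d, ExtVanishes R A M i := by
  suffices H : ∀ (I : Ideal R) (A : Type) [AddCommGroup A] [Module R A] [Module.Finite R A],
      I ≤ Module.annihilator R A → ∀ i > d, ExtVanishes R A M i from H ⊥ A bot_le
  intro I
  induction I using WellFoundedGT.induction with
  | ind I ih =>
  intro A _ _ hA
  induction hA using IsNoetherianRing.induction_on_isQuotientEquivQuotientPrime R with
  | subsingleton N => exact fun _ i _ ↦ of_subsingleton_left i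
  | quotient N p e =>
    intro hI i hi
    rw [e.annihilator_eq, Ideal.annihilator_quotient] at hI
    refine of_equiv e.symm (.refl R M) ?_
    rcases hI.lt_or_eq with hlt | heq
    · exact ih _ hlt (R ⧸ p.1) (Ideal.annihilator_quotient).ge i hi
    by_cases hp : p.1 = maximalIdeal R
    · rw [hp]; exact h i hi
    obtain ⟨x, hx, hxp⟩ := SetLike.exists_of_lt
      ((IsLocalRing.le_maximalIdeal p.2.ne_top).lt_of_ne hp)
    have hreg : IsSMulRegular (R ⧸ p.1) x := by
      refine isSMulRegular_iff_right_eq_zero_of_smul.mpr fun a ha ↦ ?_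
      exact (mul_eq_zero.mp ((Algebra.smul_def x a).symm.trans ha)).resolve_left
        (fun h0 ↦ hxp (Ideal.Quotient.eq_zero_iff_mem.mp h0))
    refine of_quotSMulTop_left hx hreg rfl (ih (p.1 ⊔ Ideal.span {x}) ?_ _ ?_ _ (by omega))
    · rw [heq]
      exact left_lt_sup.mpr fun hle ↦ hxp (hle (Ideal.mem_span_singleton_self x))
    · refine sup_le ?_ ?_
      · exact (Ideal.annihilator_quotient (I := p.1)).ge.trans
          (LinearMap.annihilator_le_of_surjective _ (Submodule.mkQ_surjective _))
      · rw [Ideal.span_singleton_le_iff_mem, Module.mem_annihilator]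
        intro m
        obtain ⟨m, rfl⟩ := Submodule.mkQ_surjective _ m
        exact (exact_lsmul_mkQ (M := R ⧸ p.1) x (x • m)).mpr ⟨m, rfl⟩
  | exact N₁ N₂ N₃ f g hf hg hfg ih₁ ih₃ =>
    intro hI i hi
    exact contravariant₂ hf hfg hg
      (ih₁ (hI.trans (LinearMap.annihilator_le_of_injective f hf)) i hi)
      (ih₃ (hI.trans (LinearMap.annihilator_le_of_surjective g hg)) i hi)

/-- If `M` has injective dimension at most `d`, then Ext into `M` vanishes above
`d` minus the depth. -/
lemma ExtVanishes.of_depth [Module.Finite R M] {d : ℕ}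
    (h : ∀ i > d, ExtVanishes R (ResidueField R) M i) (n : ℕ) (A : Type) [AddCommGroup A]
    [Module R A] [Module.Finite R A] (hA : ∀ j < n, ExtVanishes R (ResidueField R) A j)
    {i : ℕ} (hi : d < i + n) : ExtVanishes R A M i := by
  induction n generalizing A i with
  | zero => exact of_residueField h A i hi
  | succ n ih =>
    obtain ⟨x, hx, hreg⟩ := exists_isSMulRegular (hA 0 n.succ_pos)
    exact of_quotSMulTop_left hx hreg rfl (ih (QuotSMulTop x A)
      (fun j hj ↦ quotSMulTop_right hreg rfl (hA j (by omega)) (hA (j + 1) (by omega))) (by omega))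

end Depth

section FiniteLengthDuality

variable {R : Type} [CommRing R] {Q W V : Type} [AddCommGroup Q] [Module R Q]
  [AddCommGroup W] [Module R W] [AddCommGroup V] [Module R V]

lemma exists_linearMap_apply_eq {q : Q} (hq : Submodule.span R {q} = ⊤)
    (hann : Module.annihilator R Q ≤ Module.annihilator R V) (v : V) :
    ∃ φ : Q →ₗ[R] V, φ q = v := by
  have hsurj : Function.Surjective (LinearMap.toSpanSingleton R Q q) := by
    rw [← LinearMap.range_eq_top, LinearMap.range_toSpanSingleton, hq]
  have hker : LinearMap.ker (LinearMap.toSpanSingleton R Q q) ≤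
      LinearMap.ker (LinearMap.toSpanSingleton R V v) := by
    intro r hr
    have hr' : r • q = 0 := hr
    have : r ∈ Module.annihilator R Q := by
      refine Module.mem_annihilator.mpr fun m ↦ ?_
      obtain ⟨s, rfl⟩ := hsurj m
      rw [LinearMap.toSpanSingleton_apply, smul_comm, hr', smul_zero]
    exact Module.mem_annihilator.mp (hann this) v
  refine ⟨(Submodule.liftQ _ _ hker) ∘ₗ
    (LinearMap.quotKerEquivOfSurjective _ hsurj).symm.toLinearMap, ?_⟩
  have : (LinearMap.quotKerEquivOfSurjective _ hsurj).symm q = Submodule.Quotient.mk 1 := by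
    rw [LinearEquiv.symm_apply_eq]
    exact (one_smul R q).symm
  simp only [LinearMap.comp_apply, LinearEquiv.coe_coe, this]
  exact one_smul R v

lemma exists_smul_eq_of_span_eq_top {q : Q} (hq : Submodule.span R {q} = ⊤) (m : Q) :
    ∃ r : R, r • q = m :=
  Submodule.mem_span_singleton.mp (hq ▸ Submodule.mem_top)

lemma linearMap_ext_of_span_eq_top {q : Q} (hq : Submodule.span R {q} = ⊤) {φ ψ : Q →ₗ[R] V}
    (h : φ q = ψ q) : φ = ψ := by
  ext m
  obtain ⟨r, rfl⟩ := exists_smul_eq_of_span_eq_top hq m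
  rw [map_smul, map_smul, h]

variable [IsLocalRing R]

/-- `W` behaves as an injective module with one-dimensional socle with respect to the
modules of finite length killed by the annihilator of `Q`. -/
structure IsDualizingFor (R Q W : Type) [CommRing R] [IsLocalRing R] [AddCommGroup Q] [Module R Q]
    [AddCommGroup W] [Module R W] : Prop where
  exists_extend : ∀ (L : Type) [AddCommGroup L] [Module R L], IsFiniteLength R L →
    Module.annihilator R Q ≤ Module.annihilator R L → ∀ (L' : Submodule R L) (φ : L' →ₗ[R] W),
    ∃ ψ : L →ₗ[R] W, ψ ∘ₗ L'.subtype = φ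
  length_residueField : Module.length R (ResidueField R →ₗ[R] W) = 1

namespace IsDualizingFor

variable (h : IsDualizingFor R Q W)
include h

lemma length_linearMap {L : Type} [AddCommGroup L] [Module R L]
    (hL : IsFiniteLength R L) (hann : Module.annihilator R Q ≤ Module.annihilator R L) :
    Module.length R (L →ₗ[R] W) = Module.length R L := by
  induction hL with
  | of_subsingleton => rw [Module.length_eq_zero, Module.length_eq_zero]
  | @of_simple_quotient L _ _ N hN hNL ih =>
    obtain ⟨I, hI, ⟨e⟩⟩ := isSimpleModule_iff_quot_maximal.mp hN
    obtain rfl := IsLocalRing.eq_maximalIdeal hI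
    have hL : IsFiniteLength R L := .of_simple_quotient hNL
    rw [Module.length_eq_add_of_exact (LinearMap.lcomp R W N.mkQ)
      (LinearMap.lcomp R W N.subtype) (LinearMap.lcomp_injective_of_surjective _ N.mkQ_surjective)
      (h.exists_extend L hL hann N) (LinearMap.exact_lcomp_of_exact_of_surjective _
        (LinearMap.exact_subtype_mkQ N) N.mkQ_surjective),
      Module.length_eq_add_of_exact N.subtype N.mkQ N.subtype_injective N.mkQ_surjective
        (LinearMap.exact_subtype_mkQ N),
      ih (hann.trans (LinearMap.annihilator_le_of_injective _ N.subtype_injective)),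
      add_comm, Module.length_eq_one R (L ⧸ N),
      (LinearEquiv.congrLeft W R e).length_eq]
    exact congrArg _ h.length_residueField

lemma annihilator_le {q : Q} (hq : Submodule.span R {q} = ⊤) (hQ : IsFiniteLength R Q) :
    Module.annihilator R W ≤ Module.annihilator R Q := by
  intro r hr
  suffices hrq : r • q = 0 by
    refine Module.mem_annihilator.mpr fun m ↦ ?_
    obtain ⟨s, rfl⟩ := exists_smul_eq_of_span_eq_top hq m
    rw [smul_comm, hrq, smul_zero]
  by_contra hrq
  let L := Submodule.span R {r • q}
  have hL : IsFiniteLength R L := by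
    rw [← Module.length_ne_top_iff] at hQ ⊢
    exact ne_top_of_le_ne_top hQ (Module.length_le_of_injective L.subtype L.subtype_injective)
  have hlen := h.length_linearMap hL
    (LinearMap.annihilator_le_of_injective L.subtype L.subtype_injective)
  have hmem : r • q ∈ L := Submodule.mem_span_singleton_self _
  have hne : Module.length R L ≠ 0 := by
    rw [Ne, Module.length_eq_zero_iff]
    intro hs
    exact hrq (congrArg Subtype.val (hs.elim ⟨r • q, hmem⟩ 0))
  rw [← hlen, Ne, Module.length_eq_zero_iff] at hne
  refine hne (subsingleton_of_forall_eq 0 fun φ ↦ ?_)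
  obtain ⟨ψ, rfl⟩ := h.exists_extend Q hQ le_rfl L φ
  ext ⟨m, hm⟩
  obtain ⟨s, rfl⟩ := Submodule.mem_span_singleton.mp hm
  simp [Module.mem_annihilator.mp hr]

lemma exists_eq_smul_id {q : Q} (hq : Submodule.span R {q} = ⊤) (hQ : IsFiniteLength R Q)
    (hann : Module.annihilator R Q ≤ Module.annihilator R W) (φ : W →ₗ[R] W) :
    ∃ r : R, φ = r • LinearMap.id := by
  have e : (Q →ₗ[R] W) ≃ₗ[R] W := LinearEquiv.ofBijective (LinearMap.applyₗ q)
    ⟨fun _ _ h ↦ linearMap_ext_of_span_eq_top hq h, exists_linearMap_apply_eq hq hann⟩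
  have hlenW : Module.length R W = Module.length R Q := by
    rw [← e.length_eq, h.length_linearMap hQ le_rfl]
  have hW : IsFiniteLength R W := by
    rw [← Module.length_ne_top_iff, hlenW]; exact Module.length_ne_top_iff.mpr hQ
  have hlen : Module.length R (W →ₗ[R] W) = Module.length R Q := by
    rw [h.length_linearMap hW hann, hlenW]
  have hann' : Module.annihilator R Q ≤ Module.annihilator R (W →ₗ[R] W) := fun r hr ↦
    Module.mem_annihilator.mpr fun ψ ↦ LinearMap.ext fun w ↦
      Module.mem_annihilator.mp (hann hr) (ψ w)
  obtain ⟨j, hj⟩ := exists_linearMap_apply_eq hq hann' LinearMap.id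
  have hinj : Function.Injective j := by
    rw [injective_iff_map_eq_zero]
    intro m hm
    obtain ⟨r, rfl⟩ := exists_smul_eq_of_span_eq_top hq m
    rw [map_smul, hj] at hm
    exact Module.mem_annihilator.mp (h.annihilator_le hq hQ
      (Module.mem_annihilator.mpr fun w ↦ LinearMap.congr_fun hm w)) q
  have hadd := Module.length_eq_add_of_exact j (LinearMap.range j).mkQ hinj
    (Submodule.mkQ_surjective _) (LinearMap.exact_map_mkQ_range j)
  rw [hlen] at hadd
  have h0 : Module.length R ((W →ₗ[R] W) ⧸ LinearMap.range j) = 0 := by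
    have hne := Module.length_ne_top_iff.mpr hQ
    exact (ENat.add_right_injective_of_ne_top hne (hadd.symm.trans (add_zero _).symm))
  rw [Module.length_eq_zero_iff, Submodule.Quotient.subsingleton_iff] at h0
  obtain ⟨m, rfl⟩ := LinearMap.range_eq_top.mp h0 φ
  obtain ⟨r, rfl⟩ := exists_smul_eq_of_span_eq_top hq m
  exact ⟨r, by rw [map_smul, hj]⟩

end IsDualizingFor

end FiniteLengthDuality

section HigherDuality

variable {R : Type} [CommRing R] [IsLocalRing R] {Q W : Type} [AddCommGroup Q] [Module R Q]
  [AddCommGroup W] [Module R W]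

/-- The analogue of `IsDualizingFor` for the functor `Ext^n(-, W)`. -/
structure IsDualizingInDegree (R Q W : Type) [CommRing R] [IsLocalRing R] [AddCommGroup Q]
    [Module R Q] [AddCommGroup W] [Module R W] (n : ℕ) : Prop where
  exists_extend : ∀ (L : Type) [AddCommGroup L] [Module R L], IsFiniteLength R L →
    Module.annihilator R Q ≤ Module.annihilator R L → ∀ (L' : Submodule R L)
    (α : Abelian.Ext (ModuleCat.of R L') (ModuleCat.of R W) n),
    ∃ β : Abelian.Ext (ModuleCat.of R L) (ModuleCat.of R W) n,
      (Abelian.Ext.mk₀ (ModuleCat.ofHom L'.subtype)).comp β (zero_add n) = α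
  length_residueField : Module.length R
    (Abelian.Ext (ModuleCat.of R (ResidueField R)) (ModuleCat.of R W) n) = 1
  extVanishes : ∀ i < n, ExtVanishes R (ResidueField R) W i

namespace IsDualizingInDegree

lemma isDualizingFor (h : IsDualizingInDegree R Q W 0) : IsDualizingFor R Q W where
  exists_extend L _ _ hL hann L' φ := by
    obtain ⟨β, hβ⟩ := h.exists_extend L hL hann L' (Abelian.Ext.mk₀ (ModuleCat.ofHom φ))
    obtain ⟨ψ, rfl⟩ := (Abelian.Ext.mk₀_bijective _ _).2 β
    rw [Abelian.Ext.mk₀_comp_mk₀] at hβ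
    exact ⟨ψ.hom, congrArg ModuleCat.Hom.hom ((Abelian.Ext.mk₀_bijective _ _).1 hβ)⟩
  length_residueField := by
    rw [← h.length_residueField]
    exact ((Abelian.Ext.linearEquiv₀ (R := R) (X := ModuleCat.of R (ResidueField R))
      (Y := ModuleCat.of R W)).trans ModuleCat.homLinearEquiv).length_eq.symm

open Pointwise

lemma quotSMulTop {n : ℕ} (h : IsDualizingInDegree R Q W (n + 1)) {x : R}
    (hx : x ∈ maximalIdeal R) (hreg : IsSMulRegular W x) :
    IsDualizingInDegree R (QuotSMulTop x Q) (QuotSMulTop x W) n := by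
  have hS := exactShortComplex_shortExact (f := LinearMap.lsmul R W x) hreg (exact_lsmul_mkQ x)
    (Submodule.mkQ_surjective _)
  have hsmul : ∀ {A : Type} [AddCommGroup A] [Module R A] {i : ℕ}
      (y : Abelian.Ext (ModuleCat.of R A) (ModuleCat.of R W) i),
      y.comp (Abelian.Ext.mk₀ (exactShortComplex (exact_lsmul_mkQ (M := W) x)).f) (add_zero i) =
      x • y := by
    intro A _ _ i y
    change y.comp (Abelian.Ext.mk₀ (x • 𝟙 (ModuleCat.of R W))) (add_zero i) = _
    rw [Abelian.Ext.mk₀_smul, Abelian.Ext.comp_smul, Abelian.Ext.comp_mk₀_id]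
  have hkill : ∀ {A : Type} [AddCommGroup A] [Module R A] {i : ℕ}
      (y : Abelian.Ext (ModuleCat.of R A) (ModuleCat.of R W) i),
      x ∈ Module.annihilator R A → x • y = 0 := by
    intro A _ _ i y hxA
    rw [← Abelian.Ext.mk₀_id_comp y, ← Abelian.Ext.smul_comp, ← Abelian.Ext.mk₀_smul,
      show x • 𝟙 (ModuleCat.of R A) = 0 from ModuleCat.hom_ext
        (LinearMap.ext fun a ↦ Module.mem_annihilator.mp hxA a)]
    simp
  have hsurj : ∀ {A : Type} [AddCommGroup A] [Module R A]
      (y : Abelian.Ext (ModuleCat.of R A) (ModuleCat.of R W) (n + 1)),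
      x ∈ Module.annihilator R A → ∃ z : Abelian.Ext (ModuleCat.of R A)
        (ModuleCat.of R (QuotSMulTop x W)) n, z.comp hS.extClass rfl = y := by
    intro A _ _ y hxA
    exact Abelian.Ext.covariant_sequence_exact₁ _ hS y ((hsmul y).trans (hkill y hxA)) rfl
  have hinj : ∀ {A : Type} [AddCommGroup A] [Module R A]
      (z : Abelian.Ext (ModuleCat.of R A) (ModuleCat.of R (QuotSMulTop x W)) n),
      IsFiniteLength R A → z.comp hS.extClass rfl = 0 → z = 0 := by
    intro A _ _ z hA hz
    obtain ⟨y, rfl⟩ := Abelian.Ext.covariant_sequence_exact₃ _ hS z rfl hz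
    rw [((h.extVanishes n n.lt_succ_self).of_isFiniteLength hA).elim y 0, Abelian.Ext.zero_comp]
  have hxk : x ∈ Module.annihilator R (ResidueField R) := by rwa [annihilator_residueField]
  have hk : IsFiniteLength R (ResidueField R) := by
    rw [← Module.length_ne_top_iff]
    have : IsSimpleModule R (ResidueField R) :=
      isSimpleModule_iff_quot_maximal.mpr ⟨maximalIdeal R, inferInstance, ⟨.refl R _⟩⟩
    rw [Module.length_eq_one]; simp
  refine ⟨fun L _ _ hL hann L' α ↦ ?_, ?_, fun i hi ↦ ?_⟩
  · have hannQ : Module.annihilator R Q ≤ Module.annihilator R (QuotSMulTop x Q) :=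
      LinearMap.annihilator_le_of_surjective _ (Submodule.mkQ_surjective _)
    have hxQ : x ∈ Module.annihilator R (QuotSMulTop x Q) := by
      refine Module.mem_annihilator.mpr fun m ↦ ?_
      obtain ⟨m, rfl⟩ := Submodule.mkQ_surjective _ m
      exact (exact_lsmul_mkQ (M := Q) x (x • m)).mpr ⟨m, rfl⟩
    obtain ⟨β, hβ⟩ := h.exists_extend L hL (hannQ.trans hann) L' (α.comp hS.extClass rfl)
    obtain ⟨γ, rfl⟩ := hsurj β (hann hxQ)
    refine ⟨γ, sub_eq_zero.mp (hinj _ ?_ ?_)⟩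
    · rw [← Module.length_ne_top_iff] at hL ⊢
      exact ne_top_of_le_ne_top hL (Module.length_le_of_injective _ L'.subtype_injective)
    · rw [sub_eq_add_neg, Abelian.Ext.add_comp, Abelian.Ext.neg_comp, ← sub_eq_add_neg,
        sub_eq_zero, ← hβ]
      exact Abelian.Ext.comp_assoc _ _ _ _ _ (by omega)
  · rw [← h.length_residueField]
    refine (LinearEquiv.ofBijective (hS.extClass.postcompOfLinear R
      (ModuleCat.of R (ResidueField R)) (rfl : n + 1 = n + 1)) ⟨?_, ?_⟩).length_eq
    · rw [injective_iff_map_eq_zero]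
      exact fun z hz ↦ hinj z hk hz
    · exact fun y ↦ hsurj y hxk
  · exact ExtVanishes.quotSMulTop_right hreg rfl (h.extVanishes _ (by omega))
      (h.extVanishes _ (by omega))

omit [IsLocalRing R] in
lemma annihilator_quotSMulTop_le {x : R}
    (hann : Module.annihilator R Q ≤ Module.annihilator R W) {q : Q}
    (hq : Submodule.span R {q} = ⊤) :
    Module.annihilator R (QuotSMulTop x Q) ≤ Module.annihilator R (QuotSMulTop x W) := by
  intro r hr
  have h₁ : (x • (⊤ : Submodule R Q)).mkQ (r • q) = 0 := by
    rw [map_smul]; exact Module.mem_annihilator.mp hr _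
  obtain ⟨m, hm⟩ := (exact_lsmul_mkQ (M := Q) x _).mp h₁
  obtain ⟨s, rfl⟩ := exists_smul_eq_of_span_eq_top hq m
  have h₂ : r - x * s ∈ Module.annihilator R Q := by
    refine Module.mem_annihilator.mpr fun m ↦ ?_
    obtain ⟨t, rfl⟩ := exists_smul_eq_of_span_eq_top hq m
    have hm' : x • s • q = r • q := hm
    rw [smul_comm, sub_smul, mul_smul, hm', sub_self, smul_zero]
  refine Module.mem_annihilator.mpr fun m ↦ ?_
  obtain ⟨w, rfl⟩ := Submodule.mkQ_surjective _ m
  have h₃ := Module.mem_annihilator.mp (hann h₂) w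
  rw [sub_smul, sub_eq_zero, mul_smul] at h₃
  rw [← map_smul, h₃]
  exact (exact_lsmul_mkQ (M := W) x _).mpr ⟨s • w, rfl⟩

omit [IsLocalRing R] in
lemma span_mkQ_eq_top {x : R} {q : Q} (hq : Submodule.span R {q} = ⊤) :
    Submodule.span R {(x • (⊤ : Submodule R Q)).mkQ q} = ⊤ := by
  rw [← Set.image_singleton, ← Submodule.map_span, hq, Submodule.map_top, Submodule.range_mkQ]

variable [IsNoetherianRing R] [Module.Finite R Q] [Module.Finite R W]

omit [IsLocalRing R] in
lemma _root_.isFiniteLength_of_supportDim_eq_zero (h : Module.supportDim R Q = 0) :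
    IsFiniteLength R Q := by
  rw [Module.supportDim_eq_ringKrullDim_quotient_annihilator] at h
  have : Ring.KrullDimLE 0 (R ⧸ Module.annihilator R Q) := by
    rw [Ring.krullDimLE_iff, h]; rfl
  have : IsArtinianRing (R ⧸ Module.annihilator R Q) :=
    isArtinianRing_iff_krullDimLE_zero.mpr inferInstance
  rw [isFiniteLength_iff_isNoetherian_isArtinian]
  refine ⟨inferInstance, ?_⟩
  let _ : Module (R ⧸ Module.annihilator R Q) Q := Module.quotientAnnihilator
  have : IsScalarTower R (R ⧸ Module.annihilator R Q) Q :=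
    Module.isTorsionBySet_annihilator R Q |>.isScalarTower
  have : Module.Finite (R ⧸ Module.annihilator R Q) Q := .of_restrictScalars_finite R _ _
  exact isArtinian_of_surjective_algebraMap (S := R) (R := R ⧸ Module.annihilator R Q)
    Ideal.Quotient.mk_surjective

/-- Endomorphisms of a dualizing module are scalars, and it is faithful. -/
theorem exists_eq_smul_id_and_annihilator_le {n : ℕ} (h : IsDualizingInDegree R Q W n)
    (hQ : ∀ i < n, ExtVanishes R (ResidueField R) Q i) (hdim : Module.supportDim R Q = n)
    (hann : Module.annihilator R Q ≤ Module.annihilator R W) {q : Q}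
    (hq : Submodule.span R {q} = ⊤) :
    (∀ φ : W →ₗ[R] W, ∃ r : R, φ = r • LinearMap.id) ∧
      Module.annihilator R W ≤ Module.annihilator R Q := by
  induction n generalizing Q W with
  | zero =>
    have hfl : IsFiniteLength R Q := isFiniteLength_of_supportDim_eq_zero hdim
    exact ⟨h.isDualizingFor.exists_eq_smul_id hq hfl hann,
      h.isDualizingFor.annihilator_le hq hfl⟩
  | succ n ih =>
    obtain ⟨x, hx, hreg⟩ := exists_isSMulRegular (M := Q × W)
      (ExtVanishes.prod_right (hQ 0 n.succ_pos) (h.extVanishes 0 n.succ_pos))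
    have hregQ : IsSMulRegular Q x := fun a b hab ↦
      (Prod.ext_iff.mp (hreg (a₁ := (a, (0 : W))) (a₂ := (b, 0)) (Prod.ext hab rfl))).1
    have hregW : IsSMulRegular W x := fun a b hab ↦
      (Prod.ext_iff.mp (hreg (a₁ := ((0 : Q), a)) (a₂ := (0, b)) (Prod.ext rfl hab))).2
    obtain ⟨h₁, h₂⟩ := ih (h.quotSMulTop hx hregW)
      (fun i hi ↦ ExtVanishes.quotSMulTop_right hregQ rfl (hQ i (by omega)) (hQ _ (by omega)))
      (by
        have := Module.supportDim_quotSMulTop_succ_eq_supportDim_mem_jacobson hregQ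
          (IsLocalRing.maximalIdeal_le_jacobson _ hx)
        rw [hdim, Nat.cast_succ] at this
        exact ENat.WithBot.add_one_cancel.mp this)
      (annihilator_quotSMulTop_le hann hq) (span_mkQ_eq_top hq)
    refine ⟨?_, ?_⟩
    · suffices H : (⊤ : Submodule R (W →ₗ[R] W)) ≤ Submodule.span R {LinearMap.id} by
        intro φ
        obtain ⟨r, hr⟩ := Submodule.mem_span_singleton.mp (H (Submodule.mem_top (x := φ)))
        exact ⟨r, hr.symm⟩
      refine Submodule.le_of_le_smul_of_le_jacobson_bot (I := maximalIdeal R)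
        Module.Finite.fg_top (IsLocalRing.jacobson_eq_maximalIdeal ⊥ bot_ne_top).ge
        fun φ _ ↦ ?_
      have hle : x • (⊤ : Submodule R W) ≤ (x • (⊤ : Submodule R W)).comap φ := by
        intro w hw
        obtain ⟨v, -, rfl⟩ := Submodule.mem_smul_pointwise_iff_exists _ _ _ |>.mp hw
        rw [Submodule.mem_comap, map_smul]
        exact Submodule.smul_mem_pointwise_smul _ _ _ trivial
      obtain ⟨r, hr⟩ := h₁ (Submodule.mapQ _ _ φ hle)
      have hmem : ∀ w, ∃ v, LinearMap.lsmul R W x v = (φ - r • LinearMap.id : W →ₗ[R] W) w := by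
        intro w
        refine (exact_lsmul_mkQ (M := W) x _).mp ?_
        have := LinearMap.congr_fun hr (Submodule.mkQ _ w)
        rw [LinearMap.sub_apply, map_sub, sub_eq_zero]
        exact this
      let e := LinearEquiv.ofInjective (LinearMap.lsmul R W x) hregW
      let ψ : W →ₗ[R] W := e.symm.toLinearMap ∘ₗ
        (φ - r • LinearMap.id).codRestrict (LinearMap.range (LinearMap.lsmul R W x)) hmem
      have hψ : x • ψ = φ - r • LinearMap.id := by
        ext w
        have := e.apply_symm_apply (⟨(φ - r • LinearMap.id : W →ₗ[R] W) w, hmem w⟩)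
        exact congrArg Subtype.val this
      rw [← sub_add_cancel φ (r • LinearMap.id), ← hψ, add_comm]
      exact Submodule.add_mem_sup (Submodule.smul_mem _ _ (Submodule.mem_span_singleton_self _))
        (Submodule.smul_mem_smul hx trivial)
    · have hbot : Module.annihilator R W • (⊤ : Submodule R Q) = ⊥ := by
        refine Submodule.eq_bot_of_le_smul_of_le_jacobson_bot (maximalIdeal R) _
          (IsNoetherian.noetherian _) ?_ (IsLocalRing.jacobson_eq_maximalIdeal ⊥ bot_ne_top).ge
        rw [Submodule.smul_le]
        rintro r hr m -
        have hr' : r ∈ Module.annihilator R (QuotSMulTop x W) :=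
          LinearMap.annihilator_le_of_surjective _ (Submodule.mkQ_surjective _) hr
        have h₃ : (x • (⊤ : Submodule R Q)).mkQ (r • m) = 0 := by
          rw [map_smul]; exact Module.mem_annihilator.mp (h₂ hr') _
        obtain ⟨m', hm'⟩ := (exact_lsmul_mkQ (M := Q) x _).mp h₃
        obtain ⟨s, rfl⟩ := exists_smul_eq_of_span_eq_top hq m
        obtain ⟨t, rfl⟩ := exists_smul_eq_of_span_eq_top hq m'
        have hm'' : x • t • q = r • s • q := hm'
        have ht : t ∈ Module.annihilator R W := by
          refine Module.mem_annihilator.mpr fun w ↦ hregW ?_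
          have h₄ : x * t - r * s ∈ Module.annihilator R Q := by
            refine Module.mem_annihilator.mpr fun m ↦ ?_
            obtain ⟨u, rfl⟩ := exists_smul_eq_of_span_eq_top hq m
            rw [smul_comm, sub_smul, mul_smul, mul_smul, hm'', sub_self, smul_zero]
          have h₅ := Module.mem_annihilator.mp (hann h₄) w
          rw [sub_smul, mul_smul, mul_comm, mul_smul, Module.mem_annihilator.mp hr w,
            smul_zero, sub_zero] at h₅
          simpa using h₅
        rw [← hm'']
        exact Submodule.smul_mem_smul hx (Submodule.smul_mem_smul ht trivial)
      intro r hr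
      refine Module.mem_annihilator.mpr fun m ↦ ?_
      exact (Submodule.mem_bot R).mp (hbot ▸ Submodule.smul_mem_smul hr Submodule.mem_top)

end IsDualizingInDegree

end HigherDuality

section DualizingModule

/-- The properties of a canonical module of a `d`-dimensional Cohen–Macaulay local ring on
which duality rests. -/
structure IsDualizing (R ω : Type) [CommRing R] [IsLocalRing R] [AddCommGroup ω] [Module R ω]
    (d : ℕ) : Prop where
  finite : Module.Finite R ω
  extVanishes_of_gt : ∀ i > d, ExtVanishes R (ResidueField R) ω i
  extVanishes_of_lt : ∀ i < d, ExtVanishes R (ResidueField R) ω i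
  extVanishes_self : ∀ i < d, ExtVanishes R (ResidueField R) R i
  exists_eq_smul_id : ∀ φ : ω →ₗ[R] ω, ∃ r : R, φ = r • LinearMap.id
  annihilator_eq_bot : Module.annihilator R ω = ⊥

variable {R : Type} [CommRing R] [IsLocalRing R] [IsNoetherianRing R]

omit [IsNoetherianRing R] in
lemma rdepth_self_eq (hCM : IsCohenMacaulayLocalRing R) {d : ℕ} (hd : ringKrullDim R = d) :
    rdepth R R = d :=
  WithBot.coe_injective (hCM.trans hd)

theorem IsCanonicalModule.isDualizing (hCM : IsCohenMacaulayLocalRing R) {d : ℕ}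
    (hd : ringKrullDim R = d) (hd0 : 0 < d) {om : ModuleCat.{0} R}
    (hom : IsCanonicalModule R d om) : IsDualizing R om d := by
  obtain ⟨hfin, hext, ⟨e⟩⟩ := hom
  have hext' : ∀ i, i ≠ d → ExtVanishes R (ResidueField R) om i := by
    rintro (_ | i) hi
    · exact ExtVanishes.of_extGroup_zero (hext 0 hi)
    · exact (extVanishes_iff_extGroup_succ _ _ i).mp (hext _ hi)
  have hself : ∀ i < d, ExtVanishes R (ResidueField R) R i := fun i hi ↦
    ExtVanishes.of_le_rdepth (rdepth_self_eq hCM hd).ge hi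
  have hdual : IsDualizingInDegree R R om d := by
    refine ⟨fun L _ _ hL _ L' α ↦ ?_, ?_, fun i hi ↦ hext' i hi.ne⟩
    · have : Module.Finite R L := by
        have := (isFiniteLength_iff_isNoetherian_isArtinian.mp hL).1
        infer_instance
      have hv : ExtVanishes R (L ⧸ L') om (d + 1) :=
        ExtVanishes.of_residueField (d := d) (fun i hi ↦ hext' i (by omega)) _ _ (by omega)
      exact Abelian.Ext.contravariant_sequence_exact₁ (exactShortComplex_shortExact
        L'.subtype_injective (LinearMap.exact_subtype_mkQ L') L'.mkQ_surjective) _ α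
        (add_comm 1 d) (hv.elim _ _)
    · obtain ⟨p, rfl⟩ := Nat.exists_eq_succ_of_ne_zero hd0.ne'
      obtain ⟨e'⟩ := nonempty_extGroup_linearEquiv (ModuleCat.of R (ResidueField R)) om p
      have : IsSimpleModule R (ResidueField R) :=
        isSimpleModule_iff_quot_maximal.mpr ⟨maximalIdeal R, inferInstance, ⟨.refl R _⟩⟩
      rw [← Module.length_eq_one R (ResidueField R)]
      exact (e'.symm.trans e).length_eq
  have hann : Module.annihilator R R = ⊥ := Module.annihilator_eq_bot.mpr inferInstance
  obtain ⟨h₁, h₂⟩ := hdual.exists_eq_smul_id_and_annihilator_le hself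
    (by rw [Module.supportDim_self_eq_ringKrullDim, hd]) (hann.trans_le bot_le)
    (q := 1) Ideal.span_singleton_one
  exact ⟨hfin, fun i hi ↦ hext' i (by omega), fun i hi ↦ hext' i (by omega), hself, h₁,
    le_bot_iff.mp (h₂.trans_eq hann)⟩

end DualizingModule

section MaximalCohenMacaulay

variable {R : Type} [CommRing R]

lemma ExtVanishes.one_of_exists_comp_eq {A B C M : Type} [AddCommGroup A] [Module R A]
    [AddCommGroup B] [Module R B] [AddCommGroup C] [Module R C] [AddCommGroup M] [Module R M]
    {f : A →ₗ[R] B} {g : B →ₗ[R] C} (hf : Function.Injective f) (hfg : Function.Exact f g)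
    (hg : Function.Surjective g) (h : ExtVanishes R M B 1)
    (hl : ∀ φ : M →ₗ[R] C, ∃ ψ : M →ₗ[R] B, g ∘ₗ ψ = φ) : ExtVanishes R M A 1 := by
  have hS := exactShortComplex_shortExact hf hfg hg
  refine subsingleton_of_forall_eq 0 fun x ↦ ?_
  obtain ⟨y, rfl⟩ := Abelian.Ext.covariant_sequence_exact₁ _ hS x (h.elim _ _) (zero_add 1)
  obtain ⟨φ, rfl⟩ := (Abelian.Ext.mk₀_bijective _ _).2 y
  obtain ⟨ψ, hψ⟩ := hl φ.hom
  have hφ : φ = ModuleCat.ofHom ψ ≫ (exactShortComplex hfg).g := ModuleCat.hom_ext hψ.symm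
  rw [hφ, ← Abelian.Ext.mk₀_comp_mk₀, Abelian.Ext.comp_assoc _ _ _ (zero_add 0) (zero_add 1)
    (by omega), hS.comp_extClass, Abelian.Ext.comp_zero]

section Biduality

variable {ω A B : Type} [AddCommGroup ω] [Module R ω] [AddCommGroup A] [Module R A]
  [AddCommGroup B] [Module R B]

lemma bijective_applyₗ_of_equiv (e : A ≃ₗ[R] B)
    (h : Function.Bijective (LinearMap.applyₗ : A →ₗ[R] (A →ₗ[R] ω) →ₗ[R] ω)) :
    Function.Bijective (LinearMap.applyₗ : B →ₗ[R] (B →ₗ[R] ω) →ₗ[R] ω) := by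
  refine ⟨fun x y hxy ↦ ?_, fun Ψ ↦ ?_⟩
  · refine e.symm.injective (h.1 (LinearMap.ext fun φ ↦ ?_))
    exact LinearMap.congr_fun hxy (φ ∘ₗ e.symm.toLinearMap)
  · obtain ⟨a, ha⟩ := h.2 (Ψ ∘ₗ LinearMap.lcomp R ω e.symm.toLinearMap)
    refine ⟨e a, LinearMap.ext fun φ ↦ ?_⟩
    have := LinearMap.congr_fun ha (φ ∘ₗ e.toLinearMap)
    refine this.trans (congrArg Ψ (LinearMap.ext fun b ↦ ?_))
    simp

lemma bijective_applyₗ_pi (n : ℕ)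
    (h : Function.Bijective (LinearMap.applyₗ : A →ₗ[R] (A →ₗ[R] ω) →ₗ[R] ω)) :
    Function.Bijective
      (LinearMap.applyₗ : (Fin n → A) →ₗ[R] ((Fin n → A) →ₗ[R] ω) →ₗ[R] ω) := by
  refine ⟨fun x y hxy ↦ funext fun i ↦ h.1 (LinearMap.ext fun φ ↦ ?_), fun Ψ ↦ ?_⟩
  · exact LinearMap.congr_fun hxy (φ ∘ₗ LinearMap.proj i)
  · choose a ha using fun i ↦ h.2 (Ψ ∘ₗ LinearMap.lcomp R ω (LinearMap.proj i))
    refine ⟨a, LinearMap.ext fun φ ↦ ?_⟩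
    have hsum : ∀ v, φ v = ∑ i, φ (Pi.single i (v i)) := fun v ↦ by
      rw [← map_sum, Finset.univ_sum_single]
    have hφ : φ = ∑ i, LinearMap.lcomp R ω (LinearMap.proj (R := R) (φ := fun _ : Fin n ↦ A) i)
        (φ ∘ₗ LinearMap.single R (fun _ ↦ A) i) := by
      refine LinearMap.ext fun v ↦ ?_
      rw [LinearMap.sum_apply]
      exact hsum v
    conv_rhs => rw [hφ, map_sum]
    refine (hsum a).trans (Finset.sum_congr rfl fun i _ ↦ ?_)
    exact LinearMap.congr_fun (ha i) (φ ∘ₗ LinearMap.single R (fun _ ↦ A) i)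

end Biduality

variable [IsLocalRing R]

/-- Maximal Cohen–Macaulay modules, where `d` is the dimension of the ring; the zero module is
allowed. -/
structure IsMCM (R A : Type) [CommRing R] [IsLocalRing R] [AddCommGroup A] [Module R A]
    (d : ℕ) : Prop where
  finite : Module.Finite R A
  extVanishes : ∀ i < d, ExtVanishes R (ResidueField R) A i

variable {A B C : Type} [AddCommGroup A] [Module R A] [AddCommGroup B] [Module R B]
  [AddCommGroup C] [Module R C] {d : ℕ}

omit [IsLocalRing R] in
lemma ExtVanishes.of_kernel {M : Type} [AddCommGroup M] [Module R M] {f : A →ₗ[R] B}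
    {g : B →ₗ[R] C} (hf : Function.Injective f) (hfg : Function.Exact f g)
    (hg : Function.Surjective g) {i : ℕ} (h₂ : ExtVanishes R M B i)
    (h₃ : ∀ j, j + 1 = i → ExtVanishes R M C j) : ExtVanishes R M A i := by
  cases i with
  | zero =>
    rw [zero_iff] at h₂ ⊢
    exact subsingleton_of_forall_eq 0 fun φ ↦ LinearMap.ext fun m ↦ hf
      (LinearMap.congr_fun (h₂.elim (f ∘ₗ φ) (f ∘ₗ 0)) m)
  | succ i => exact covariant₁ hf hfg hg rfl (h₃ i rfl) h₂

omit [IsLocalRing R] in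
/-- Depth propagates along an infinite chain of short exact sequences to the right. -/
lemma ExtVanishes.of_tower {M : Type} [AddCommGroup M] [Module R M] {H G : ℕ → Type}
    [∀ n, AddCommGroup (H n)] [∀ n, Module R (H n)] [∀ n, AddCommGroup (G n)]
    [∀ n, Module R (G n)] {f : ∀ n, H n →ₗ[R] G n} {g : ∀ n, G n →ₗ[R] H (n + 1)}
    (hf : ∀ n, Function.Injective (f n)) (hfg : ∀ n, Function.Exact (f n) (g n))
    (hg : ∀ n, Function.Surjective (g n)) (i : ℕ)
    (h : ∀ j ≤ i, ∀ n, ExtVanishes R M (G n) j) (n : ℕ) : ExtVanishes R M (H n) i := by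
  induction i generalizing n with
  | zero => exact of_kernel (hf n) (hfg n) (hg n) (h 0 le_rfl n) (by omega)
  | succ i ih =>
    exact covariant₁ (hf n) (hfg n) (hg n) rfl (ih (fun j hj ↦ h j (by omega)) _) (h _ le_rfl n)

namespace IsMCM

lemma of_equiv (e : A ≃ₗ[R] B) (h : IsMCM R A d) : IsMCM R B d :=
  have := h.finite
  ⟨.equiv e, fun i hi ↦ (h.extVanishes i hi).of_equiv (.refl R _) e⟩

lemma of_subsingleton [Subsingleton A] : IsMCM R A d :=
  ⟨inferInstance, fun i _ ↦ ExtVanishes.of_subsingleton_right i⟩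

lemma pi (h : IsMCM R A d) (n : ℕ) : IsMCM R (Fin n → A) d :=
  have := h.finite
  ⟨inferInstance, fun i hi ↦ (h.extVanishes i hi).pi_right n⟩

lemma prod (h : IsMCM R A d) (h' : IsMCM R B d) : IsMCM R (A × B) d :=
  have := h.finite
  have := h'.finite
  ⟨inferInstance, fun i hi ↦ (h.extVanishes i hi).prod_right (h'.extVanishes i hi)⟩

lemma of_kernel [IsNoetherianRing R] {f : A →ₗ[R] B} {g : B →ₗ[R] C} (hf : Function.Injective f)
    (hfg : Function.Exact f g) (hg : Function.Surjective g) (hB : IsMCM R B d)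
    (hC : IsMCM R C d) : IsMCM R A d :=
  have := hB.finite
  ⟨Module.Finite.of_injective f hf, fun i hi ↦
    ExtVanishes.of_kernel hf hfg hg (hB.extVanishes i hi) fun j hj ↦ hC.extVanishes j (by omega)⟩

lemma of_extension {f : A →ₗ[R] B} {g : B →ₗ[R] C} (hf : Function.Injective f)
    (hfg : Function.Exact f g) (hg : Function.Surjective g) (hA : IsMCM R A d)
    (hC : IsMCM R C d) : IsMCM R B d :=
  have := hA.finite
  have := hC.finite
  ⟨.of_exact hfg hg, fun i hi ↦
    ExtVanishes.covariant₂ hf hfg hg (hA.extVanishes i hi) (hC.extVanishes i hi)⟩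

lemma of_tower [IsNoetherianRing R] {H G : ℕ → Type}
    [∀ n, AddCommGroup (H n)] [∀ n, Module R (H n)] [∀ n, AddCommGroup (G n)]
    [∀ n, Module R (G n)] {f : ∀ n, H n →ₗ[R] G n} {g : ∀ n, G n →ₗ[R] H (n + 1)}
    (hf : ∀ n, Function.Injective (f n)) (hfg : ∀ n, Function.Exact (f n) (g n))
    (hg : ∀ n, Function.Surjective (g n)) (hG : ∀ n, IsMCM R (G n) d) (n : ℕ) :
    IsMCM R (H n) d :=
  have := (hG n).finite
  ⟨.of_injective (f n) (hf n), fun i hi ↦ ExtVanishes.of_tower hf hfg hg i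
    (fun j hj n ↦ (hG n).extVanishes j (by omega)) n⟩

end IsMCM

end MaximalCohenMacaulay

section Duality

variable {R ω : Type} [CommRing R] [IsLocalRing R] [IsNoetherianRing R] [AddCommGroup ω]
  [Module R ω] {d : ℕ} {A : Type} [AddCommGroup A] [Module R A]

lemma SyzygyTower.isMCM {Z : ℕ → Type} [∀ n, AddCommGroup (Z n)] [∀ n, Module R (Z n)]
    (T : SyzygyTower R Z) (hR : IsMCM R R d) (h : IsMCM R (Z 0) d) (n : ℕ) : IsMCM R (Z n) d := by
  induction n with
  | zero => exact h
  | succ n ih =>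
    exact IsMCM.of_kernel (T.injective n) (T.exact n) (T.surjective n) (hR.pi _) ih

/-- Homomorphisms out of a finite power. -/
noncomputable def piDualEquiv (R ω A : Type) [CommRing R] [AddCommGroup ω]
    [Module R ω] [AddCommGroup A] [Module R A] (n : ℕ) :
    (Fin n → A →ₗ[R] ω) ≃ₗ[R] ((Fin n → A) →ₗ[R] ω) :=
  LinearMap.lsum R (fun _ ↦ A) R

namespace IsDualizing

variable (hω : IsDualizing R ω d)
include hω

omit [IsNoetherianRing R] in
lemma isMCM : IsMCM R ω d := ⟨hω.finite, hω.extVanishes_of_lt⟩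

omit [IsNoetherianRing R] in
lemma isMCM_self : IsMCM R R d := ⟨inferInstance, hω.extVanishes_self⟩

lemma extVanishes (hA : IsMCM R A d) {i : ℕ} (hi : 0 < i) : ExtVanishes R A ω i :=
  have := hω.finite
  have := hA.finite
  ExtVanishes.of_depth hω.extVanishes_of_gt d A hA.extVanishes (by omega)

lemma surjective_lcomp {A B C : Type} [AddCommGroup A] [Module R A] [AddCommGroup B] [Module R B]
    [AddCommGroup C] [Module R C] {f : A →ₗ[R] B} {g : B →ₗ[R] C} (hf : Function.Injective f)
    (hfg : Function.Exact f g) (hg : Function.Surjective g) (hC : IsMCM R C d) :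
    Function.Surjective (LinearMap.lcomp R ω f) :=
  ExtVanishes.surjective_lcomp hf hfg hg (hω.extVanishes hC one_pos)

omit hω [IsNoetherianRing R] in
lemma _root_.IsMCM.dual_pi (h : IsMCM R (A →ₗ[R] ω) d) (n : ℕ) :
    IsMCM R ((Fin n → A) →ₗ[R] ω) d :=
  (h.pi n).of_equiv (piDualEquiv R ω A n)

omit [IsNoetherianRing R] in
lemma isMCM_dual_self : IsMCM R (R →ₗ[R] ω) d :=
  hω.isMCM.of_equiv (LinearMap.ringLmapEquivSelf R R ω).symm

lemma isMCM_dual (hA : IsMCM R A d) : IsMCM R (A →ₗ[R] ω) d := by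
  have := hA.finite
  let T := syzygyTower R A
  have hT := T.isMCM hω.isMCM_self hA
  exact IsMCM.of_tower (H := fun n ↦ Syzygy R A n →ₗ[R] ω)
    (f := fun n ↦ LinearMap.lcomp R ω (T.π n))
    (g := fun n ↦ LinearMap.lcomp R ω (T.ι n))
    (fun n ↦ LinearMap.lcomp_injective_of_surjective _ (T.surjective n))
    (fun n ↦ LinearMap.exact_lcomp_of_exact_of_surjective _ (T.exact n) (T.surjective n))
    (fun n ↦ hω.surjective_lcomp (T.injective n) (T.exact n) (T.surjective n) (hT n))
    (fun n ↦ hω.isMCM_dual_self.dual_pi _) 0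

omit [IsNoetherianRing R] in
lemma bijective_applyₗ_self :
    Function.Bijective (LinearMap.applyₗ : R →ₗ[R] (R →ₗ[R] ω) →ₗ[R] ω) := by
  have hφ : ∀ (φ : R →ₗ[R] ω), φ = LinearMap.toSpanSingleton R ω (φ 1) := fun φ ↦ by ext; simp
  constructor
  · rw [injective_iff_map_eq_zero]
    intro r hr
    refine (Submodule.mem_bot R).mp (hω.annihilator_eq_bot ▸ Module.mem_annihilator.mpr fun w ↦ ?_)
    exact LinearMap.congr_fun hr (LinearMap.toSpanSingleton R ω w)
  · intro Ψ
    obtain ⟨r, hr⟩ := hω.exists_eq_smul_id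
      (Ψ ∘ₗ (LinearMap.ringLmapEquivSelf R R ω).symm.toLinearMap)
    refine ⟨r, LinearMap.ext fun φ ↦ ?_⟩
    have := LinearMap.congr_fun hr (φ 1)
    have h₁ : (LinearMap.ringLmapEquivSelf R R ω).symm (φ 1) = φ := by
      rw [LinearEquiv.symm_apply_eq]; rfl
    rw [LinearMap.comp_apply, LinearEquiv.coe_coe, h₁] at this
    rw [this, LinearMap.applyₗ_apply_apply, ← mul_one r, ← smul_eq_mul, map_smul]
    simp

/-- A tower of presentations by reflexive modules whose dual sequences are exact consists of
reflexive modules and injective maps. -/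
theorem bijective_applyₗ_and_injective_of_tower {B C : ℕ → Type}
    [∀ n, AddCommGroup (B n)] [∀ n, Module R (B n)] [∀ n, AddCommGroup (C n)]
    [∀ n, Module R (C n)] {f : ∀ n, B (n + 1) →ₗ[R] C n} {g : ∀ n, C n →ₗ[R] B n}
    (hfg : ∀ n, Function.Exact (f n) (g n)) (hg : ∀ n, Function.Surjective (g n))
    (hC : ∀ n, Function.Bijective (LinearMap.applyₗ : C n →ₗ[R] (C n →ₗ[R] ω) →ₗ[R] ω))
    (hC' : ∀ n, IsMCM R (C n →ₗ[R] ω) d)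
    (hf : ∀ n, Function.Surjective (LinearMap.lcomp R ω (f n))) (n : ℕ) :
    Function.Bijective (LinearMap.applyₗ : B n →ₗ[R] (B n →ₗ[R] ω) →ₗ[R] ω) ∧
      Function.Injective (f n) := by
  have hg' : ∀ n, Function.Injective (LinearMap.lcomp R ω (g n)) := fun n ↦
    LinearMap.lcomp_injective_of_surjective _ (hg n)
  have hfg' : ∀ n, Function.Exact (LinearMap.lcomp R ω (g n)) (LinearMap.lcomp R ω (f n)) :=
    fun n ↦ LinearMap.exact_lcomp_of_exact_of_surjective _ (hfg n) (hg n)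
  have hB : ∀ n, IsMCM R (B n →ₗ[R] ω) d :=
    IsMCM.of_tower (H := fun n ↦ B n →ₗ[R] ω) hg' hfg' hf hC'
  have hsurj : ∀ n, Function.Surjective
      (LinearMap.applyₗ : B n →ₗ[R] (B n →ₗ[R] ω) →ₗ[R] ω) := by
    intro n Ψ
    obtain ⟨Φ, rfl⟩ := hω.surjective_lcomp (hg' n) (hfg' n) (hf n) (hB (n + 1)) Ψ
    obtain ⟨c, rfl⟩ := (hC n).2 Φ
    exact ⟨g n c, rfl⟩
  have hinj : ∀ n, Function.Injective
      (LinearMap.applyₗ : B n →ₗ[R] (B n →ₗ[R] ω) →ₗ[R] ω) := by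
    intro n
    rw [injective_iff_map_eq_zero]
    intro b hb
    obtain ⟨c, rfl⟩ := hg n b
    obtain ⟨Φ, hΦ⟩ := (LinearMap.exact_lcomp_of_exact_of_surjective ω (hfg' n) (hf n)
      (LinearMap.applyₗ c)).mp hb
    obtain ⟨b', rfl⟩ := hsurj (n + 1) Φ
    rw [← (hC n).1 (a₁ := f n b') (a₂ := c) hΦ, (hfg n).apply_apply_eq_zero]
  have hff : Function.Injective (LinearMap.lcomp R ω (LinearMap.lcomp R ω (f n))) :=
    LinearMap.lcomp_injective_of_surjective _ (hf n)
  exact ⟨⟨hinj n, hsurj n⟩, fun b b' hbb ↦ hinj (n + 1)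
    (hff (LinearMap.ext fun φ ↦ congrArg φ hbb))⟩

end IsDualizing

end Duality

section TorIndependence

open TensorProduct

variable {R ω : Type} [CommRing R] [IsLocalRing R] [IsNoetherianRing R] [AddCommGroup ω]
  [Module R ω] {d : ℕ} {A : Type} [AddCommGroup A] [Module R A]
  {Z : ℕ → Type} [∀ n, AddCommGroup (Z n)] [∀ n, Module R (Z n)] (T : SyzygyTower R Z)

/-- All positive Tor modules of `A` with the bottom of the tower vanish. -/
def SyzygyTower.TorIndependent {R : Type} [CommRing R] {Z : ℕ → Type} [∀ n, AddCommGroup (Z n)]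
    [∀ n, Module R (Z n)] (T : SyzygyTower R Z) (A : Type) [AddCommGroup A] [Module R A] : Prop :=
  ∀ n, Function.Injective (LinearMap.lTensor A (T.ι n))

/-- Tensoring with a finite free module. -/
noncomputable def tensorPiEquiv (R A : Type) [CommRing R] [AddCommGroup A] [Module R A] (n : ℕ) :
    (Fin n → A) ≃ₗ[R] A ⊗[R] (Fin n → R) :=
  (TensorProduct.piScalarRight R R A (Fin n)).symm

omit [IsLocalRing R] [IsNoetherianRing R] in
lemma bijective_applyₗ_tensor_pi (n : ℕ)
    (h : Function.Bijective (LinearMap.applyₗ : A →ₗ[R] (A →ₗ[R] ω) →ₗ[R] ω)) :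
    Function.Bijective (LinearMap.applyₗ :
      (A ⊗[R] (Fin n → R)) →ₗ[R] (A ⊗[R] (Fin n → R) →ₗ[R] ω) →ₗ[R] ω) :=
  bijective_applyₗ_of_equiv (tensorPiEquiv R A n) (bijective_applyₗ_pi n h)

omit [IsNoetherianRing R] in
lemma IsMCM.dual_tensor_pi (h : IsMCM R (A →ₗ[R] ω) d) (n : ℕ) :
    IsMCM R (A ⊗[R] (Fin n → R) →ₗ[R] ω) d :=
  (h.dual_pi n).of_equiv ((tensorPiEquiv R A n).congrLeft ω R)

namespace IsDualizing

variable (hω : IsDualizing R ω d)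
include hω

/-- The first Ext groups into duals of free modules vanish. -/
lemma extVanishes_dual_pi (hA : IsMCM R A d) (n : ℕ) {i : ℕ} (hi : 0 < i) :
    ExtVanishes R A ((Fin n → R) →ₗ[R] ω) i :=
  ((hω.extVanishes hA hi).pi_right n).of_equiv (.refl R A)
    ((LinearEquiv.piCongrRight fun _ ↦ (LinearMap.ringLmapEquivSelf R R ω).symm).trans
      (piDualEquiv R ω R n))

omit [IsLocalRing R] [IsNoetherianRing R] hω in
lemma _root_.SyzygyTower.lcomp_π_injective (n : ℕ) :
    Function.Injective (LinearMap.lcomp R ω (T.π n)) :=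
  LinearMap.lcomp_injective_of_surjective _ (T.surjective n)

omit [IsLocalRing R] [IsNoetherianRing R] hω in
lemma _root_.SyzygyTower.exact_lcomp (n : ℕ) :
    Function.Exact (LinearMap.lcomp R ω (T.π n)) (LinearMap.lcomp R ω (T.ι n)) :=
  LinearMap.exact_lcomp_of_exact_of_surjective _ (T.exact n) (T.surjective n)

lemma lcomp_ι_surjective (hZ : IsMCM R (Z 0) d) (n : ℕ) :
    Function.Surjective (LinearMap.lcomp R ω (T.ι n)) :=
  hω.surjective_lcomp (T.injective n) (T.exact n) (T.surjective n) (T.isMCM hω.isMCM_self hZ n)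

/-- Vanishing of Ext into a dual gives biduality for tensor products and Tor-independence. -/
lemma bijective_applyₗ_and_injective (hA : IsMCM R A d) (hZ : IsMCM R (Z 0) d)
    (hAA : Function.Bijective (LinearMap.applyₗ : A →ₗ[R] (A →ₗ[R] ω) →ₗ[R] ω))
    (h : ∀ i > 0, ExtVanishes R A (Z 0 →ₗ[R] ω) i) (n : ℕ) :
    Function.Bijective (LinearMap.applyₗ :
      (A ⊗[R] Z n) →ₗ[R] (A ⊗[R] Z n →ₗ[R] ω) →ₗ[R] ω) ∧
      Function.Injective (LinearMap.lTensor A (T.ι n)) := by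
  have hext : ∀ n, ∀ i > 0, ExtVanishes R A (Z n →ₗ[R] ω) i := by
    intro n
    induction n with
    | zero => exact h
    | succ n ih =>
      intro i hi
      exact ExtVanishes.covariant₃ (T.lcomp_π_injective n) (T.exact_lcomp n)
        (hω.lcomp_ι_surjective T hZ n) rfl (hω.extVanishes_dual_pi hA _ hi) (ih _ (by omega))
  refine hω.bijective_applyₗ_and_injective_of_tower (B := fun n ↦ A ⊗[R] Z n)
    (g := fun n ↦ LinearMap.lTensor A (T.π n))
    (fun n ↦ lTensor_exact A (T.exact n) (T.surjective n))
    (fun n ↦ LinearMap.lTensor_surjective A (T.surjective n))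
    (fun n ↦ bijective_applyₗ_tensor_pi _ hAA)
    (fun n ↦ (hω.isMCM_dual hA).dual_tensor_pi _) (fun n φ ↦ ?_) n
  obtain ⟨ψ, hψ⟩ := ExtVanishes.exists_comp_eq (T.lcomp_π_injective n) (T.exact_lcomp n)
    (hω.lcomp_ι_surjective T hZ n) (hext n 1 one_pos) (TensorProduct.curry φ)
  refine ⟨TensorProduct.lift ψ, TensorProduct.ext' fun a z ↦ ?_⟩
  exact LinearMap.congr_fun (LinearMap.congr_fun hψ a) z

/-- Maximal Cohen–Macaulay modules are reflexive with respect to `ω`. -/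
theorem bijective_applyₗ (hA : IsMCM R A d) :
    Function.Bijective (LinearMap.applyₗ : A →ₗ[R] (A →ₗ[R] ω) →ₗ[R] ω) := by
  have := hA.finite
  exact bijective_applyₗ_of_equiv (TensorProduct.lid R A)
    (hω.bijective_applyₗ_and_injective (syzygyTower R A) hω.isMCM_self hA hω.bijective_applyₗ_self
      (fun i hi ↦ ExtVanishes.of_projective hi) 0).1

/-- The duality isomorphism. -/
noncomputable def bidualEquiv (hA : IsMCM R A d) : A ≃ₗ[R] ((A →ₗ[R] ω) →ₗ[R] ω) :=
  LinearEquiv.ofBijective LinearMap.applyₗ (hω.bijective_applyₗ hA)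

lemma torIndependent (hA : IsMCM R A d) (hZ : IsMCM R (Z 0) d)
    (h : ∀ i > 0, ExtVanishes R A (Z 0 →ₗ[R] ω) i) : T.TorIndependent A := fun n ↦
  (hω.bijective_applyₗ_and_injective T hA hZ (hω.bijective_applyₗ hA) h n).2

/-- If the first Tor module vanishes and the tensor product is maximal Cohen–Macaulay, then the
first Ext group into the dual vanishes. -/
lemma extVanishes_one_dual (hA : IsMCM R A d) (hZ : IsMCM R (Z 0) d)
    (hinj : Function.Injective (LinearMap.lTensor A (T.ι 0))) (hAZ : IsMCM R (A ⊗[R] Z 0) d) :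
    ExtVanishes R A (Z 0 →ₗ[R] ω) 1 := by
  refine ExtVanishes.one_of_exists_comp_eq (T.lcomp_π_injective 0) (T.exact_lcomp 0)
    (hω.lcomp_ι_surjective T hZ 0) (hω.extVanishes_dual_pi hA _ one_pos) fun φ ↦ ?_
  obtain ⟨ψ, hψ⟩ := hω.surjective_lcomp hinj (lTensor_exact A (T.exact 0) (T.surjective 0))
    (LinearMap.lTensor_surjective A (T.surjective 0)) hAZ (TensorProduct.lift φ)
  refine ⟨TensorProduct.curry ψ, LinearMap.ext fun a ↦ LinearMap.ext fun z ↦ ?_⟩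
  exact LinearMap.congr_fun hψ (a ⊗ₜ z)

end IsDualizing

/-- The depth formula for maximal Cohen–Macaulay modules. -/
lemma IsMCM.tensor (hdep : PropDep R) (hdepth : rdepth R R = d) (hA : IsMCM R A d)
    (hZ : IsMCM R (Z 0) d) (hT : T.TorIndependent A) : IsMCM R (A ⊗[R] Z 0) d := by
  have := hA.finite
  have := hZ.finite
  rcases subsingleton_or_nontrivial A with hA0 | hA0
  · exact .of_subsingleton
  rcases subsingleton_or_nontrivial (Z 0) with hZ0 | hZ0
  · exact .of_subsingleton
  rcases subsingleton_or_nontrivial (A ⊗[R] Z 0) with hAZ | hAZ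
  · exact .of_subsingleton
  refine ⟨inferInstance, fun i hi ↦ ExtVanishes.of_le_rdepth (n := d) ?_ hi⟩
  have h := hdep A (Z 0) hA.finite hZ.finite hA0 hZ0 fun i hi ↦ T.subsingleton_torGroup hT hi
  rw [hdepth] at h
  have h₁ := add_le_add (le_rdepth hA.extVanishes) (le_rdepth hZ.extVanishes)
  rw [← h] at h₁
  exact (ENat.add_le_add_iff_right (ENat.natCast_ne_top d)).mp h₁

end TorIndependence

section Pushout

variable {R A B C A' : Type} [CommRing R] [AddCommGroup A] [Module R A] [AddCommGroup B]
  [Module R B] [AddCommGroup C] [Module R C] [AddCommGroup A'] [Module R A']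
  (f : A →ₗ[R] B) (u : A →ₗ[R] A') (g : B →ₗ[R] C)

/-- The pushout of two linear maps with a common source. -/
abbrev LinearPushout : Type := (A' × B) ⧸ (LinearMap.range (u.prod (-f)))

namespace LinearPushout

/-- The quotient map onto the pushout. -/
abbrev mk : A' × B →ₗ[R] LinearPushout f u := (LinearMap.range (u.prod (-f))).mkQ

/-- The left inclusion. -/
abbrev inl : A' →ₗ[R] LinearPushout f u := mk f u ∘ₗ LinearMap.inl R A' B

/-- The right inclusion. -/
abbrev inr : B →ₗ[R] LinearPushout f u := mk f u ∘ₗ LinearMap.inr R A' B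

lemma condition (a : A) : inr f u (f a) = inl f u (u a) := by
  rw [eq_comm, ← sub_eq_zero]
  simp only [LinearMap.comp_apply, ← map_sub]
  refine (Submodule.Quotient.mk_eq_zero _).mpr ⟨a, ?_⟩
  simp

variable {f u} in
lemma mk_exact : Function.Exact (u.prod (-f)) (mk f u) := by
  intro y
  rw [← LinearMap.mem_ker, Submodule.ker_mkQ]
  rfl

variable {f u} in
lemma mk_surjective : Function.Surjective (mk f u) := Submodule.mkQ_surjective _

variable {f} in
lemma inl_injective (hf : Function.Injective f) : Function.Injective (inl f u) := by
  rw [injective_iff_map_eq_zero]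
  intro a ha
  obtain ⟨y, hy⟩ := (mk_exact _).mp ha
  have h₁ : u y = a := congrArg Prod.fst hy
  have h₂ : -f y = 0 := congrArg Prod.snd hy
  rw [← h₁, (map_eq_zero_iff f hf).mp (neg_eq_zero.mp h₂), map_zero]

variable {u} in
lemma inr_injective (hu : Function.Injective u) : Function.Injective (inr f u) := by
  rw [injective_iff_map_eq_zero]
  intro b hb
  obtain ⟨y, hy⟩ := (mk_exact _).mp hb
  have h₁ : u y = 0 := congrArg Prod.fst hy
  have h₂ : -f y = b := congrArg Prod.snd hy
  rw [← h₂, (map_eq_zero_iff u hu).mp h₁, map_zero, neg_zero]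

variable {f g} (hfg : Function.Exact f g) (hg : Function.Surjective g)

/-- The map from the pushout to the cokernel of `f`. -/
def desc (hfg : Function.Exact f g) : LinearPushout f u →ₗ[R] C :=
  (LinearMap.range (u.prod (-f))).liftQ (g ∘ₗ LinearMap.snd R A' B) <| by
    rintro _ ⟨a, rfl⟩
    simp [hfg.apply_apply_eq_zero]

@[simp]
lemma desc_mk (y : A' × B) : desc u hfg (mk f u y) = g y.2 := rfl

include hg in
lemma desc_surjective : Function.Surjective (desc u hfg) := fun c ↦ by
  obtain ⟨b, rfl⟩ := hg c
  exact ⟨mk f u (0, b), rfl⟩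

lemma exact_inl_desc : Function.Exact (inl f u) (desc u hfg) := by
  intro y
  obtain ⟨⟨a, b⟩, rfl⟩ := mk_surjective y
  constructor
  · intro h
    obtain ⟨c, rfl⟩ := (hfg b).mp h
    refine ⟨a + u c, ?_⟩
    rw [map_add, ← condition, LinearMap.comp_apply, LinearMap.comp_apply, ← map_add]
    simp
  · rintro ⟨c, hc⟩
    rw [← hc]
    exact (desc_mk u hfg _).trans (map_zero g)

variable {C' : Type} [AddCommGroup C'] [Module R C'] (f) {u} {v : A' →ₗ[R] C'}
  (huv : Function.Exact u v) (hv : Function.Surjective v)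

/-- The map from the pushout to the cokernel of `u`. -/
def desc' (huv : Function.Exact u v) : LinearPushout f u →ₗ[R] C' :=
  (LinearMap.range (u.prod (-f))).liftQ (v ∘ₗ LinearMap.fst R A' B) <| by
    rintro _ ⟨a, rfl⟩
    simp [huv.apply_apply_eq_zero]

@[simp]
lemma desc'_mk (y : A' × B) : desc' f huv (mk f u y) = v y.1 := rfl

include hv in
lemma desc'_surjective : Function.Surjective (desc' f huv) := fun c ↦ by
  obtain ⟨b, rfl⟩ := hv c
  exact ⟨mk f u (b, 0), rfl⟩

lemma exact_inr_desc' : Function.Exact (inr f u) (desc' f huv) := by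
  intro y
  obtain ⟨⟨a, b⟩, rfl⟩ := mk_surjective y
  constructor
  · intro h
    obtain ⟨c, rfl⟩ := (huv a).mp h
    refine ⟨b + f c, ?_⟩
    rw [map_add, condition, LinearMap.comp_apply, LinearMap.comp_apply, ← map_add]
    simp
  · rintro ⟨c, hc⟩
    rw [← hc]
    exact (desc'_mk f huv _).trans (map_zero v)

end LinearPushout

end Pushout

section TorIndependentExtensions

open TensorProduct

variable {R : Type} [CommRing R] {A B C : Type} [AddCommGroup A] [Module R A]
  [AddCommGroup B] [Module R B] [AddCommGroup C] [Module R C]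
  {Z : ℕ → Type} [∀ n, AddCommGroup (Z n)] [∀ n, Module R (Z n)] {T : SyzygyTower R Z}

lemma LinearMap.rTensor_lTensor {X Y : Type} [AddCommGroup X] [Module R X] [AddCommGroup Y]
    [Module R Y] (f : A →ₗ[R] B) (g : X →ₗ[R] Y) (t : A ⊗[R] X) :
    f.rTensor Y (g.lTensor A t) = g.lTensor B (f.rTensor X t) := by
  rw [← LinearMap.comp_apply, ← LinearMap.comp_apply, LinearMap.rTensor_comp_lTensor,
    LinearMap.lTensor_comp_rTensor]

namespace SyzygyTower.TorIndependent

lemma of_flat [Module.Flat R A] : T.TorIndependent A := fun n ↦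
  Module.Flat.lTensor_preserves_injective_linearMap _ (T.injective n)

lemma prod (hA : T.TorIndependent A) (hB : T.TorIndependent B) : T.TorIndependent (A × B) := by
  intro n
  rw [injective_iff_map_eq_zero]
  intro t ht
  have h₁ : (LinearMap.fst R A B).rTensor (Z (n + 1)) t = 0 := by
    refine (map_eq_zero_iff _ (hA n)).mp ?_
    rw [← LinearMap.rTensor_lTensor, ht, map_zero]
  have h₂ : (LinearMap.snd R A B).rTensor (Z (n + 1)) t = 0 := by
    refine (map_eq_zero_iff _ (hB n)).mp ?_
    rw [← LinearMap.rTensor_lTensor, ht, map_zero]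
  have h₃ : LinearMap.inl R A B ∘ₗ LinearMap.fst R A B + LinearMap.inr R A B ∘ₗ LinearMap.snd R A B
      = LinearMap.id := by
    ext <;> simp
  have := LinearMap.congr_fun (LinearMap.rTensor_id (R := R) (Z (n + 1)) (A × B)) t
  rw [← h₃, LinearMap.rTensor_add, LinearMap.rTensor_comp, LinearMap.rTensor_comp,
    LinearMap.add_apply, LinearMap.comp_apply, LinearMap.comp_apply, h₁, h₂, map_zero, map_zero,
    add_zero] at this
  exact this.symm

variable {f : A →ₗ[R] B} {g : B →ₗ[R] C}

/-- Tor-independence passes to cokernels, provided the bottom Tor module also vanishes. -/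
lemma of_exact (hf : Function.Injective f) (hfg : Function.Exact f g)
    (hg : Function.Surjective g) (h₀ : Function.Injective (f.rTensor (Z 0)))
    (hA : T.TorIndependent A) (hB : T.TorIndependent B) : T.TorIndependent C := by
  have hfZ : ∀ n, Function.Injective (f.rTensor (Z n)) := by
    intro n
    cases n with
    | zero => exact h₀
    | succ n =>
      rw [injective_iff_map_eq_zero]
      intro t ht
      have hflat : Function.Injective (f.rTensor (Fin (T.rank n) → R)) :=
        Module.Flat.rTensor_preserves_injective_linearMap _ hf
      refine (map_eq_zero_iff _ (hA n)).mp ((map_eq_zero_iff _ hflat).mp ?_)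
      rw [LinearMap.rTensor_lTensor, ht, map_zero]
  intro n
  rw [injective_iff_map_eq_zero]
  intro c hc
  obtain ⟨b, rfl⟩ := LinearMap.rTensor_surjective (Z (n + 1)) hg c
  rw [← LinearMap.rTensor_lTensor] at hc
  obtain ⟨a, ha⟩ := (rTensor_exact _ hfg hg _).mp hc
  have ha' : (T.π n).lTensor A a = 0 := by
    refine (map_eq_zero_iff _ (hfZ n)).mp ?_
    rw [LinearMap.rTensor_lTensor, ha,
      (lTensor_exact B (T.exact n) (T.surjective n)).apply_apply_eq_zero]
  obtain ⟨a, rfl⟩ := (lTensor_exact A (T.exact n) (T.surjective n) _).mp ha'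
  rw [LinearMap.rTensor_lTensor] at ha
  rw [← hB n ha]
  exact (rTensor_exact _ hfg hg).apply_apply_eq_zero a

end SyzygyTower.TorIndependent

end TorIndependentExtensions

section Core

open TensorProduct LinearPushout

variable {R : Type} [CommRing R] {A B C M : Type} [AddCommGroup A] [Module R A]
  [AddCommGroup B] [Module R B] [AddCommGroup C] [Module R C] [AddCommGroup M] [Module R M]

/-- If Ext vanishes on the pushout of an extension along multiplication by `x`, then every
extension class of the cokernel coming from the kernel is divisible by `x`. -/
lemma ExtVanishes.exists_eq_smul_of_pushout {f : A →ₗ[R] B} {g : B →ₗ[R] C}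
    (hf : Function.Injective f) (hfg : Function.Exact f g) (hg : Function.Surjective g) (x : R)
    (h : ExtVanishes R (LinearPushout f (x • LinearMap.id : A →ₗ[R] A)) M 1)
    (e : Abelian.Ext (ModuleCat.of R C) (ModuleCat.of R M) 1) : ∃ e', e = x • e' := by
  let u : A →ₗ[R] A := x • LinearMap.id
  have hF := exactShortComplex_shortExact hf hfg hg
  have hE := exactShortComplex_shortExact (inl_injective u hf) (exact_inl_desc u hfg)
    (desc_surjective u hfg hg)
  let τ : exactShortComplex hfg ⟶ exactShortComplex (exact_inl_desc u hfg) :=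
    { τ₁ := x • 𝟙 (ModuleCat.of R A)
      τ₂ := ModuleCat.ofHom (inr f u)
      τ₃ := 𝟙 _
      comm₁₂ := ModuleCat.hom_ext (LinearMap.ext fun a ↦ (condition f u a).symm)
      comm₂₃ := ModuleCat.hom_ext (LinearMap.ext fun b ↦ rfl) }
  have hτ : x • hF.extClass = hE.extClass := by
    have h₀ : hF.extClass.comp (Abelian.Ext.mk₀ (x • 𝟙 (ModuleCat.of R A))) (add_zero 1) =
      (Abelian.Ext.mk₀ (𝟙 (ModuleCat.of R C))).comp hE.extClass (zero_add 1) :=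
      ShortComplex.ShortExact.extClass_naturality hF hE τ
    rw [Abelian.Ext.mk₀_smul, Abelian.Ext.comp_smul, Abelian.Ext.mk₀_id_comp] at h₀
    rw [← h₀]
    congr 1
    exact (Abelian.Ext.comp_mk₀_id _).symm
  obtain ⟨y, hy⟩ := Abelian.Ext.contravariant_sequence_exact₃ hE _ e (h.elim _ _) (add_zero 1)
  refine ⟨hF.extClass.comp y (add_zero 1), ?_⟩
  rw [← hy, ← hτ, Abelian.Ext.smul_comp]

variable [IsLocalRing R] [IsNoetherianRing R] {ω L : Type} [AddCommGroup ω] [Module R ω]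
  [AddCommGroup L] [Module R L] {d : ℕ}
  {Z : ℕ → Type} [∀ n, AddCommGroup (Z n)] [∀ n, Module R (Z n)] (T : SyzygyTower R Z)

namespace IsDualizing

variable (hω : IsDualizing R ω d) (hdep : PropDep R) (hd : 0 < d) (hdepth : rdepth R R = d)
include T hω hdep hd hdepth

lemma extVanishes_one_of_forall_gt_one (hL : IsMCM R L d) (hZ : IsMCM R (Z 0) d)
    (h : ∀ i > 1, ExtVanishes R L (Z 0 →ₗ[R] ω) i) : ExtVanishes R L (Z 0 →ₗ[R] ω) 1 := by
  have := hL.finite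
  have := (hω.isMCM_dual hZ).finite
  let S := syzygyTower R L
  have hK : IsMCM R (Syzygy R L 1) d := S.isMCM hω.isMCM_self hL 1
  have hKT : T.TorIndependent (Syzygy R L 1) := by
    refine hω.torIndependent T hK hZ fun i hi ↦ ?_
    exact ExtVanishes.contravariant₁ (S.injective 0) (S.exact 0) (S.surjective 0) rfl
      (.of_projective hi) (h _ (by omega))
  have hKZ := IsMCM.tensor T hdep hdepth hK hZ hKT
  have := hKZ.finite
  obtain ⟨x, hx, hreg⟩ := exists_isSMulRegular (hKZ.extVanishes 0 hd)
  let u : Syzygy R L 1 →ₗ[R] Syzygy R L 1 := x • LinearMap.id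
  let s := u.prod (-S.ι 0)
  have hs : Function.Injective s := fun a b hab ↦
    S.injective 0 (neg_injective (congrArg Prod.snd hab))
  have hs₀ : Function.Injective (s.rTensor (Z 0)) := by
    have hu : Function.Injective (u.rTensor (Z 0)) := by
      rw [LinearMap.rTensor_smul, LinearMap.rTensor_id]
      exact hreg
    have hcomp : u.rTensor (Z 0) = (LinearMap.fst R _ _).rTensor (Z 0) ∘ₗ s.rTensor (Z 0) := by
      rw [← LinearMap.rTensor_comp]
      rfl
    rw [hcomp, LinearMap.coe_comp] at hu
    exact hu.of_comp
  have hE : IsMCM R (LinearPushout (S.ι 0) u) d :=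
    IsMCM.of_extension (inl_injective u (S.injective 0)) (exact_inl_desc u (S.exact 0))
      (desc_surjective u (S.exact 0) (S.surjective 0)) hK hL
  have hET : T.TorIndependent (LinearPushout (S.ι 0) u) :=
    .of_exact hs mk_exact mk_surjective hs₀ hKT (hKT.prod .of_flat)
  refine .of_forall_eq_smul hx fun e ↦ ?_
  exact ExtVanishes.exists_eq_smul_of_pushout (S.injective 0) (S.exact 0) (S.surjective 0) x
    (hω.extVanishes_one_dual T hE hZ (hET 0) (IsMCM.tensor T hdep hdepth hE hZ hET)) e

/-- Under the depth formula, eventual vanishing of Ext between maximal Cohen–Macaulay modules is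
vanishing in all positive degrees. -/
theorem extVanishes_dual_of_forall_gt (hZ : IsMCM R (Z 0) d) (t : ℕ) (hL : IsMCM R L d)
    (h : ∀ i > t, ExtVanishes R L (Z 0 →ₗ[R] ω) i) : ∀ i > 0, ExtVanishes R L (Z 0 →ₗ[R] ω) i := by
  induction t generalizing L with
  | zero => exact h
  | succ t ih =>
    have := hL.finite
    let S := syzygyTower R L
    have hK := ih (S.isMCM hω.isMCM_self hL 1) fun i hi ↦
      ExtVanishes.contravariant₁ (S.injective 0) (S.exact 0) (S.surjective 0) rfl
        (.of_projective (by omega)) (h (i + 1) (by omega))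
    have hgt : ∀ i > 1, ExtVanishes R L (Z 0 →ₗ[R] ω) i := fun i hi ↦
      ExtVanishes.contravariant₃ (i := i - 1) (S.injective 0) (S.exact 0) (S.surjective 0)
        (by omega) (hK _ (by omega)) (.of_projective (by omega))
    intro i hi
    rcases eq_or_ne i 1 with rfl | hi1
    · exact hω.extVanishes_one_of_forall_gt_one T hdep hd hdepth hL hZ hgt
    · exact hgt i (by omega)

end IsDualizing

end Core

namespace LinearPushout

variable {R A B A' Y : Type} [CommRing R] [AddCommGroup A] [Module R A] [AddCommGroup B]
  [Module R B] [AddCommGroup A'] [Module R A'] [AddCommGroup Y] [Module R Y]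
  (f : A →ₗ[R] B) {u : A →ₗ[R] A'}

lemma inr_surjective (hu : Function.Surjective u) : Function.Surjective (inr f u) := fun y ↦ by
  obtain ⟨⟨a, b⟩, rfl⟩ := mk_surjective y
  obtain ⟨a, rfl⟩ := hu a
  refine ⟨f a + b, ?_⟩
  rw [map_add, condition, LinearMap.comp_apply, LinearMap.comp_apply, ← map_add]
  simp

lemma exact_comp_inr {v : Y →ₗ[R] A} (hvu : Function.Exact v u) :
    Function.Exact (f ∘ₗ v) (inr f u) := by
  intro b
  constructor
  · intro hb
    obtain ⟨y, hy⟩ := (mk_exact _).mp hb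
    obtain ⟨y, rfl⟩ := (hvu y).mp (congrArg Prod.fst hy)
    exact ⟨-y, by rw [map_neg]; exact congrArg Prod.snd hy⟩
  · rintro ⟨y, rfl⟩
    exact (condition f u (v y)).trans (by rw [hvu.apply_apply_eq_zero, map_zero])

end LinearPushout

section Approximation

open LinearPushout

variable {R ω : Type} [CommRing R] [IsLocalRing R] [IsNoetherianRing R] [AddCommGroup ω]
  [Module R ω] {d : ℕ}

/-- `N` is the cokernel of an injection `Y → X` where `X` is maximal Cohen–Macaulay and all
Ext groups into `Y` vanish above degree `d`. -/
def HasMCMApproximation (R N : Type) [CommRing R] [IsLocalRing R] [AddCommGroup N] [Module R N]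
    (d : ℕ) : Prop :=
  ∃ (Y X : Type) (_ : AddCommGroup Y) (_ : Module R Y) (_ : AddCommGroup X) (_ : Module R X)
    (f : Y →ₗ[R] X) (g : X →ₗ[R] N), Function.Injective f ∧ Function.Exact f g ∧
      Function.Surjective g ∧ IsMCM R X d ∧
      ∀ (M : Type) [AddCommGroup M] [Module R M] [Module.Finite R M], ∀ i > d, ExtVanishes R M Y i

namespace IsDualizing

variable (hω : IsDualizing R ω d)
include hω

lemma extVanishes_dual_pi_of_gt (M : Type) [AddCommGroup M] [Module R M] [Module.Finite R M]
    (n : ℕ) {i : ℕ} (hi : d < i) : ExtVanishes R M ((Fin n → R) →ₗ[R] ω) i :=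
  have := hω.finite
  ((ExtVanishes.of_residueField hω.extVanishes_of_gt M i hi).pi_right n).of_equiv (.refl R M)
    ((LinearEquiv.piCongrRight fun _ ↦ (LinearMap.ringLmapEquivSelf R R ω).symm).trans
      (piDualEquiv R ω R n))

lemma hasMCMApproximation_of_kernel {N K : Type} [AddCommGroup N] [Module R N] [AddCommGroup K]
    [Module R K] {n : ℕ} {ι : K →ₗ[R] (Fin n → R)} {π : (Fin n → R) →ₗ[R] N}
    (hι : Function.Injective ι) (hιπ : Function.Exact ι π) (hπ : Function.Surjective π)
    (h : HasMCMApproximation R K d) : HasMCMApproximation R N d := by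
  obtain ⟨Y, X, _, _, _, _, a, b, ha, hab, hb, hX, hY⟩ := h
  have := (hω.isMCM_dual hX).finite
  let S := syzygyTower R (X →ₗ[R] ω)
  have hS := S.isMCM hω.isMCM_self (hω.isMCM_dual hX)
  let w := LinearMap.lcomp R ω (S.π 0) ∘ₗ (hω.bidualEquiv hX).toLinearMap
  let c := LinearMap.lcomp R ω (S.ι 0)
  have hw : Function.Injective w :=
    (S.lcomp_π_injective 0).comp (hω.bidualEquiv hX).injective
  have hwc : Function.Exact w c := by
    intro y
    rw [S.exact_lcomp 0 y]
    exact ((hω.bidualEquiv hX).surjective.range_comp _ ▸ Iff.rfl)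
  have hc : Function.Surjective c := hω.lcomp_ι_surjective S (hω.isMCM_dual hX) 0
  have hu : Function.Injective (inl w b) := inl_injective b hw
  refine ⟨LinearPushout w b, LinearPushout ι (inl w b), _, _, _, _, inl ι (inl w b),
    desc _ hιπ, inl_injective _ hι, exact_inl_desc _ hιπ, desc_surjective _ hιπ hπ, ?_, ?_⟩
  · exact IsMCM.of_extension (inr_injective ι hu) (exact_inr_desc' ι (exact_inl_desc b hwc))
      (desc'_surjective ι _ (desc_surjective b hwc hc)) (hω.isMCM_self.pi n)
      (hω.isMCM_dual (hS 1))
  · intro M _ _ _ i hi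
    exact ExtVanishes.covariant₃ (f := w ∘ₗ a) (hw.comp ha) (exact_comp_inr w hab)
      (inr_surjective w hb) rfl
      (hω.extVanishes_dual_pi_of_gt M _ hi) (hY M (i + 1) (by omega))

/-- Maximal Cohen–Macaulay approximations exist. -/
theorem hasMCMApproximation {N : Type} [AddCommGroup N] [Module R N] [Module.Finite R N] (n : ℕ)
    (h : ∀ i, i + n < d → ExtVanishes R (ResidueField R) N i) : HasMCMApproximation R N d := by
  induction n generalizing N with
  | zero =>
    refine ⟨PUnit, N, inferInstance, inferInstance, inferInstance, inferInstance, 0, .id,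
      Function.injective_of_subsingleton _, ?_, Function.surjective_id, ⟨inferInstance, h⟩,
      fun M _ _ _ i _ ↦ ExtVanishes.of_subsingleton_right i⟩
    exact (LinearMap.exact_zero_iff_injective _ _).mpr Function.injective_id
  | succ n ih =>
    let S := syzygyTower R N
    refine hω.hasMCMApproximation_of_kernel (S.injective 0) (S.exact 0) (S.surjective 0) (ih ?_)
    intro i hi
    exact ExtVanishes.of_kernel (S.injective 0) (S.exact 0) (S.surjective 0)
      ((hω.isMCM_self.pi _).extVanishes i (by omega)) fun j hj ↦ h j (by omega)

end IsDualizing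

end Approximation

section Bound

variable {R ω : Type} [CommRing R] [IsLocalRing R] [IsNoetherianRing R] [AddCommGroup ω]
  [Module R ω] {d : ℕ}

namespace IsDualizing

variable (hω : IsDualizing R ω d) (hdep : PropDep R) (hd : 0 < d) (hdepth : rdepth R R = d)
include hω hdep hd hdepth

lemma extVanishes_of_isMCM_right {M X : Type} [AddCommGroup M] [Module R M] [AddCommGroup X]
    [Module R X] [Module.Finite R M] (hX : IsMCM R X d) (n t : ℕ)
    (hM : ∀ i, i + n < d → ExtVanishes R (ResidueField R) M i)
    (h : ∀ i > t, ExtVanishes R M X i) : ∀ i > n, ExtVanishes R M X i := by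
  induction n generalizing M with
  | zero =>
    have hDX := hω.isMCM_dual hX
    have := hDX.finite
    have e := hω.bidualEquiv hX
    exact fun i hi ↦ (hω.extVanishes_dual_of_forall_gt (syzygyTower R (X →ₗ[R] ω)) hdep hd hdepth
      hDX t ⟨inferInstance, hM⟩ (fun i hi ↦ (h i hi).of_equiv (.refl R M) e) i hi).of_equiv
        (.refl R M) e.symm
  | succ n ih =>
    let S := syzygyTower R M
    have hK := ih (M := Syzygy R M 1)
      (fun i hi ↦ ExtVanishes.of_kernel (S.injective 0) (S.exact 0) (S.surjective 0)
        ((hω.isMCM_self.pi _).extVanishes i (by omega)) fun j hj ↦ hM j (by omega))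
      (fun i hi ↦ ExtVanishes.contravariant₁ (S.injective 0) (S.exact 0) (S.surjective 0) rfl
        (.of_projective (by omega)) (h (i + 1) (by omega)))
    exact fun i hi ↦ ExtVanishes.contravariant₃ (i := i - 1) (S.injective 0) (S.exact 0)
      (S.surjective 0) (by omega) (hK _ (by omega)) (.of_projective (by omega))

/-- Under the depth formula, eventual vanishing of Ext implies vanishing above the dimension. -/
theorem extVanishes_of_forall_gt {M N : Type} [AddCommGroup M] [Module R M] [AddCommGroup N]
    [Module R N] [Module.Finite R M] [Module.Finite R N] (t : ℕ)
    (h : ∀ i > t, ExtVanishes R M N i) : ∀ i > d, ExtVanishes R M N i := by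
  obtain ⟨Y, X, _, _, _, _, f, g, hf, hfg, hg, hX, hY⟩ :=
    hω.hasMCMApproximation (N := N) d (by omega)
  have hMX := hω.extVanishes_of_isMCM_right hdep hd hdepth (M := M) hX d (t + d) (by omega)
    fun i hi ↦ ExtVanishes.covariant₂ hf hfg hg (hY M i (by omega)) (h i (by omega))
  exact fun i hi ↦ ExtVanishes.covariant₃ hf hfg hg rfl (hMX i hi) (hY M (i + 1) (by omega))

end IsDualizing

end Bound

/-- over a CM local ring of dimension `d > 0` with a canonical module
satisfying the depth formula, eventual Ext vanishing implies vanishing beyond `d`. -/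
theorem stmt17 (R : Type) [CommRing R] [IsLocalRing R] [IsNoetherianRing R]
    (hCM : IsCohenMacaulayLocalRing R) (d : ℕ) (hd : ringKrullDim R = d) (hd0 : 0 < d)
    (om : ModuleCat.{0} R) (hom : IsCanonicalModule R d om)
    (h : PropDep R) :
    ∀ M N : ModuleCat.{0} R, Module.Finite R M → Module.Finite R N →
      ExtEventuallyZero R M N → ∀ i > d, Subsingleton (ExtGroup R i M N) := by
  rintro M N hM hN ⟨t, ht⟩ i hi
  have hω := IsCanonicalModule.isDualizing hCM hd hd0 hom
  obtain ⟨i, rfl⟩ := Nat.exists_eq_succ_of_ne_zero (by omega : i ≠ 0)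
  refine (extVanishes_iff_extGroup_succ M N i).mpr ?_
  refine hω.extVanishes_of_forall_gt h hd0 (rdepth_self_eq hCM hd) t (fun j hj ↦ ?_) (i + 1) hi
  obtain ⟨j, rfl⟩ := Nat.exists_eq_succ_of_ne_zero (by omega : j ≠ 0)
  exact (extVanishes_iff_extGroup_succ M N j).mp (ht _ hj)
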